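/- arXiv:1703.06425 — 3 statements merged into one kernel-verified Lean document; each statement's English description precedes it below -/
import Mathlib

section
/- Let λ be an l-multipartition of n with multicharge κ ∈ ℤ^l, in type C_∞ or type C^(1)_ℓ. For every standard λ-tableau T, −Σ (α_{ν_a}, α_{ν_b}), summed over all pairs 1 ≤ a < b ≤ n with w^T(a) > w^T(b), equals deg T − deg t^λ, where ν = (ν_1,…,ν_n) = res t^λ is the residue sequence of the initial tableau. (The left-hand side is the homogeneous degree of the element ψ_{w^T} e(res t^λ) of the quiver Hecke algebra, for any reduced expression of w^T.) -/
/-- A node `(r, c, t)` of (the Young diagram of) an `l`-multipartition: row `r`,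
column `c`, component `t`, all 1-based. -/
abbrev MNode : Type := ℕ × ℕ × ℕ

/-- The simple transposition `sᵢ = (i, i+1)`. -/
def sgen (i : ℕ) : Equiv.Perm ℕ := Equiv.swap i (i + 1)

/-- The Coxeter length of a permutation supported on `{1, …, n}`:
its number of inversions among `1, …, n`. -/
def invLen (n : ℕ) (w : Equiv.Perm ℕ) : ℕ :=
  ((Finset.Icc 1 n ×ˢ Finset.Icc 1 n).filter fun p => p.1 < p.2 ∧ w p.2 < w p.1).card

/-- `w` fixes every letter outside `{1, …, n}` (i.e. `w ∈ S_n`). -/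
def FixOut (n : ℕ) (w : Equiv.Perm ℕ) : Prop := ∀ m, m ∉ Set.Icc 1 n → w m = m

namespace MP

/-- `lam t r` is the length `λ^(t)_r` of the `r`-th row (1-based) of the `t`-th component
of an `l`-multipartition of `n`: each component is weakly decreasing, rows beyond the `n`-th
are empty, each row has length at most `n`, and the total number of boxes is `n`. -/
def IsMP (l n : ℕ) (lam : ℕ → ℕ → ℕ) : Prop :=
  (∀ t r, 1 ≤ r → lam t (r + 1) ≤ lam t r) ∧
  (∀ t r, n < r → lam t r = 0) ∧
  (∀ t r, lam t r ≤ n) ∧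
  (∑ t ∈ Finset.Icc 1 l, ∑ r ∈ Finset.Icc 1 n, lam t r) = n

/-- The Young diagram `[λ]` of the multipartition. -/
def diag (l : ℕ) (lam : ℕ → ℕ → ℕ) : Set MNode :=
  {x | 1 ≤ x.1 ∧ 1 ≤ x.2.1 ∧ 1 ≤ x.2.2 ∧ x.2.2 ≤ l ∧ x.2.1 ≤ lam x.2.2 x.1}

/-- A `λ`-tableau: a bijection `[λ] → {1, …, n}`. -/
def IsTab (l n : ℕ) (lam : ℕ → ℕ → ℕ) (T : MNode → ℕ) : Prop :=
  Set.BijOn T (diag l lam) (Set.Icc 1 n)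

/-- Entries increase from left to right along the rows of each component. -/
def RowStrict (l : ℕ) (lam : ℕ → ℕ → ℕ) (T : MNode → ℕ) : Prop :=
  ∀ r c t, (r, c, t) ∈ diag l lam → (r, c + 1, t) ∈ diag l lam →
    T (r, c, t) < T (r, c + 1, t)

/-- Entries increase down the columns of each component. -/
def ColStrict (l : ℕ) (lam : ℕ → ℕ → ℕ) (T : MNode → ℕ) : Prop :=
  ∀ r c t, (r, c, t) ∈ diag l lam → (r + 1, c, t) ∈ diag l lam →
    T (r, c, t) < T (r + 1, c, t)

/-- A standard `λ`-tableau. -/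
def IsStd (l n : ℕ) (lam : ℕ → ℕ → ℕ) (T : MNode → ℕ) : Prop :=
  IsTab l n lam T ∧ RowStrict l lam T ∧ ColStrict l lam T

/-- The initial tableau `t^λ`, filling `1, …, n` along successive rows of `λ^(1)`,
then of `λ^(2)`, and so on. -/
def itab (n : ℕ) (lam : ℕ → ℕ → ℕ) (x : MNode) : ℕ :=
  (∑ t' ∈ Finset.Ico 1 x.2.2, ∑ r' ∈ Finset.Icc 1 n, lam t' r') +
  (∑ r' ∈ Finset.Ico 1 x.1, lam x.2.2 r') + x.2.1

/-- `(r, c, t)` is a Garnir node of `[λ]`. -/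
def IsGarnir (l : ℕ) (lam : ℕ → ℕ → ℕ) (r c t : ℕ) : Prop :=
  (r, c, t) ∈ diag l lam ∧ (r + 1, c, t) ∈ diag l lam

/-- The Garnir belt `B^A` of the Garnir node `A = (r, c, t)`. -/
def belt (lam : ℕ → ℕ → ℕ) (r c t : ℕ) : Set MNode :=
  {x | (x.1 = r ∧ x.2.2 = t ∧ c ≤ x.2.1 ∧ x.2.1 ≤ lam t r) ∨
       (x.1 = r + 1 ∧ x.2.2 = t ∧ 1 ≤ x.2.1 ∧ x.2.1 ≤ c)}

/-- The Garnir tableau `g^A` of the Garnir node `A = (r, c, t)`: it agrees with `t^λ`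
outside the Garnir belt, and the entries `u, …, v` (`u = t^λ(r,c,t)`, `v = t^λ(r+1,c,t)`)
fill the belt in increasing order, first along row `r+1` and then along row `r`,
each from left to right. -/
def gtab (n : ℕ) (lam : ℕ → ℕ → ℕ) (r c t : ℕ) : MNode → ℕ := fun x =>
  if x.1 = r + 1 ∧ x.2.2 = t ∧ 1 ≤ x.2.1 ∧ x.2.1 ≤ c then
    itab n lam (r, c, t) + (x.2.1 - 1)
  else if x.1 = r ∧ x.2.2 = t ∧ c ≤ x.2.1 then
    itab n lam (r, c, t) + c + (x.2.1 - c)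
  else itab n lam x

/-- `w` is the permutation `w^T` associated to the tableau `T`, i.e. `w ∈ S_n`
and `w t^λ = T`. -/
def PermOf (l n : ℕ) (lam : ℕ → ℕ → ℕ) (T : MNode → ℕ) (w : Equiv.Perm ℕ) : Prop :=
  FixOut n w ∧ ∀ x ∈ diag l lam, w (itab n lam x) = T x

/-- The left (weak Bruhat) order: `v ≥_L w` iff `v = u w` with `ℓ(v) = ℓ(u) + ℓ(w)`. -/
def LeftGe (n : ℕ) (v w : Equiv.Perm ℕ) : Prop :=
  ∃ u : Equiv.Perm ℕ, FixOut n u ∧ v = u * w ∧ invLen n v = invLen n u + invLen n w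

/-- The left order on `λ`-tableaux: `T ≥_L T'` iff `w^T ≥_L w^{T'}`. -/
def TabGe (l n : ℕ) (lam : ℕ → ℕ → ℕ) (T T' : MNode → ℕ) : Prop :=
  ∃ wT wT' : Equiv.Perm ℕ, PermOf l n lam T wT ∧ PermOf l n lam T' wT' ∧ LeftGe n wT wT'

end MP

open MP

/-- The symmetric bilinear form `(α_i, α_j)` in type `C_∞`. -/
def BInf (i j : ℕ) : ℤ :=
  if i = j then (if i = 0 then 4 else 2)
  else if min i j = 0 ∧ max i j = 1 then -2
  else if max i j = min i j + 1 then -1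
  else 0

/-- The symmetric bilinear form `(α_i, α_j)` in type `C^(1)_ℓ` (`L = ℓ ≥ 2`). -/
def BAff (L : ℕ) (i j : ℕ) : ℤ :=
  if i = j then (if i = 0 ∨ i = L then 4 else 2)
  else if (min i j = 0 ∧ max i j = 1) ∨ (min i j = L - 1 ∧ max i j = L) then -2
  else if max i j = min i j + 1 then -1
  else 0

/-- The residue map `π_ℓ : ℤ → {0, …, ℓ}` of type `C^(1)_ℓ`: it depends only on
`k mod 2ℓ` and sends `0 ↦ 0`, `ℓ ↦ ℓ`, and `j, 2ℓ − j ↦ j` for `1 ≤ j ≤ ℓ − 1`. -/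
def resAff (L : ℕ) (z : ℤ) : ℕ :=
  if (z % (2 * L)).toNat ≤ L then (z % (2 * L)).toNat else 2 * L - (z % (2 * L)).toNat

/-- The residue of the node `(r, c, t)` for multicharge `κ` and residue map `res`. -/
def resNode (res : ℤ → ℕ) (κ : ℕ → ℤ) (x : MNode) : ℕ :=
  res (κ x.2.2 + (x.2.1 : ℤ) - (x.1 : ℤ))

/-- `y` is below `x`: `y` lies in a later component, or in the same component and in
a lower row. -/
def Below (x y : MNode) : Prop := x.2.2 < y.2.2 ∨ (x.2.2 = y.2.2 ∧ x.1 < y.1)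

/-- The addable `i`-nodes of the diagram `S` lying below the node `A`. -/
def addBelow (l : ℕ) (resN : MNode → ℕ) (S : Set MNode) (i : ℕ) (A : MNode) :
    Set MNode :=
  {y | 1 ≤ y.1 ∧ 1 ≤ y.2.1 ∧ 1 ≤ y.2.2 ∧ y.2.2 ≤ l ∧ y ∉ S ∧ resN y = i ∧
       (y.1 = 1 ∨ (y.1 - 1, y.2.1, y.2.2) ∈ S) ∧
       (y.2.1 = 1 ∨ (y.1, y.2.1 - 1, y.2.2) ∈ S) ∧ Below A y}

/-- The removable `i`-nodes of the diagram `S` lying below the node `A`. -/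
def remBelow (resN : MNode → ℕ) (S : Set MNode) (i : ℕ) (A : MNode) : Set MNode :=
  {y | y ∈ S ∧ resN y = i ∧ (y.1 + 1, y.2.1, y.2.2) ∉ S ∧ (y.1, y.2.1 + 1, y.2.2) ∉ S ∧
       Below A y}

/-- `d_A` of a diagram `S`: `d_i` times (number of addable `i`-nodes below `A` minus
number of removable `i`-nodes below `A`), where `i = res A` and `d_i = (α_i, α_i)/2`. -/
noncomputable def dA (l : ℕ) (B : ℕ → ℕ → ℤ) (resN : MNode → ℕ) (S : Set MNode) (A : MNode) : ℤ :=
  (B (resN A) (resN A) / 2) *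
    (((addBelow l resN S (resN A) A).ncard : ℤ) - ((remBelow resN S (resN A) A).ncard : ℤ))

/-- The Young diagram as a finset (valid under the bounds in `IsMP`). -/
def diagF (l n : ℕ) (lam : ℕ → ℕ → ℕ) : Finset MNode :=
  ((Finset.Icc 1 n) ×ˢ (Finset.Icc 1 n) ×ˢ (Finset.Icc 1 l)).filter
    (fun x => x.2.1 ≤ lam x.2.2 x.1)

/-- The degree of a standard tableau `T`: the sum over the nodes `x` of `[λ]` of
`d_x` applied to the subdiagram of entries `≤ T x` (this is the closed form of the
recursion `deg T = deg T↓(n−1) + d_A(λ)`, `A = T⁻¹(n)`). -/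
noncomputable def degT (l n : ℕ) (lam : ℕ → ℕ → ℕ) (B : ℕ → ℕ → ℤ) (resN : MNode → ℕ)
    (T : MNode → ℕ) : ℤ :=
  ∑ x ∈ diagF l n lam, dA l B resN {y | y ∈ diag l lam ∧ T y ≤ T x} x

/-- The function `k ↦ d_i [res k = i]` on contents. -/
def resWeight (B : ℕ → ℕ → ℤ) (res : ℤ → ℕ) (i : ℕ) (k : ℤ) : ℤ :=
  if res k = i then B i i / 2 else 0

theorem BInf_eq_resWeight (i : ℕ) (k : ℤ) :
    BInf i k.natAbs = 2 * resWeight BInf Int.natAbs i k - resWeight BInf Int.natAbs i (k - 1)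
      - resWeight BInf Int.natAbs i (k + 1) := by
  have hd : BInf i i / 2 = if i = 0 then 2 else 1 := by
    unfold BInf; split_ifs <;> simp_all
  simp only [resWeight, hd]
  unfold BInf
  split_ifs <;> omega

theorem resAff_le {L : ℕ} (hL : 2 ≤ L) (z : ℤ) : resAff L z ≤ L := by
  unfold resAff
  have h0 := Int.emod_nonneg z (b := 2 * L) (by omega)
  have h1 := Int.emod_lt_of_pos z (b := 2 * L) (by omega)
  split_ifs <;> omega

theorem BAff_eq_resWeight {L : ℕ} (hL : 2 ≤ L) {i : ℕ} (hi : i ≤ L) (k : ℤ) :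
    BAff L i (resAff L k) = 2 * resWeight (BAff L) (resAff L) i k
      - resWeight (BAff L) (resAff L) i (k - 1) - resWeight (BAff L) (resAff L) i (k + 1) := by
  have hd : BAff L i i / 2 = if i = 0 ∨ i = L then 2 else 1 := by
    unfold BAff; split_ifs <;> simp_all
  have h0 := Int.emod_nonneg k (b := 2 * L) (by omega)
  have h1 := Int.emod_lt_of_pos k (b := 2 * L) (by omega)
  have hp : (k + 1) % (2 * L) = if k % (2 * L) = 2 * L - 1 then 0 else k % (2 * L) + 1 := by
    rw [Int.add_emod, Int.emod_eq_of_lt (a := 1) (by omega) (by omega)]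
    split_ifs with h
    · rw [h]; simp
    · exact Int.emod_eq_of_lt (by omega) (by omega)
  have hm : (k - 1) % (2 * L) = if k % (2 * L) = 0 then 2 * (L : ℤ) - 1 else k % (2 * L) - 1 := by
    rw [Int.sub_emod, Int.emod_eq_of_lt (a := 1) (by omega) (by omega)]
    split_ifs with h
    · rw [h, ← Int.add_emod_right, Int.emod_eq_of_lt (by omega) (by omega)]; ring
    · exact Int.emod_eq_of_lt (by omega) (by omega)
  obtain ⟨m, hmk⟩ := Int.eq_ofNat_of_zero_le h0
  rw [hmk] at hp hm h1
  have rk : resAff L k = if m ≤ L then m else 2 * L - m := by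
    unfold resAff; rw [hmk]; simp
  have rp : resAff L (k + 1) = if m + 1 ≤ L then m + 1 else 2 * L - (m + 1) := by
    unfold resAff; rw [hp]; split_ifs <;> omega
  have rm : resAff L (k - 1) = if m = 0 then 1 else if m ≤ L + 1 then m - 1 else 2 * L + 1 - m := by
    unfold resAff; rw [hm]; split_ifs <;> omega
  simp only [resWeight, hd, rk, rp, rm]
  have hmid : ∀ j, 0 < j → j < L → BAff L i j = 2 * (if j = i then if i = 0 ∨ i = L then 2 else 1
      else 0) - (if j - 1 = i then if i = 0 ∨ i = L then 2 else 1 else 0)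
      - (if j + 1 = i then if i = 0 ∨ i = L then 2 else 1 else 0) := by
    intro j hj hj'
    unfold BAff
    split_ifs <;> omega
  rcases lt_trichotomy m L with h | h | h
  · rcases Nat.eq_zero_or_pos m with h' | h'
    · subst h'
      unfold BAff
      simp
      split_ifs <;> omega
    · simp only [show m ≤ L by omega, show m + 1 ≤ L by omega, show m ≤ L + 1 by omega,
        show m ≠ 0 by omega, if_true, if_false, hmid m h' h]
  · subst h
    unfold BAff
    simp only [show ¬ (m + 1 ≤ m) by omega, show m ≤ m + 1 by omega, show m ≠ 0 by omega,
      le_refl, if_true, if_false]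
    split_ifs <;> omega
  · rw [if_neg (by omega : ¬ m ≤ L), if_neg (by omega : ¬ m + 1 ≤ L), if_neg (by omega : m ≠ 0),
      show (if m ≤ L + 1 then m - 1 else 2 * L + 1 - m) = 2 * L - m + 1 by split_ifs <;> omega,
      show 2 * L - (m + 1) = 2 * L - m - 1 by omega, hmid (2 * L - m) (by omega) (by omega)]
    ring

theorem sum_row_telescope (f : ℤ → ℤ) (x : ℤ) (m : ℕ) :
    ∑ c ∈ Finset.Icc 1 m, (2 * f (x + c) - f (x + c - 1) - f (x + c + 1))
      = f (x + 1) - f x + f (x + m) - f (x + m + 1) := by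
  induction m with
  | zero => simp
  | succ m ih =>
    rw [Finset.sum_Icc_succ_top (by omega), ih]
    push_cast
    rw [show x + ((m : ℤ) + 1) - 1 = x + m by ring, show x + ((m : ℤ) + 1) = x + m + 1 by ring]
    ring

theorem sum_rows_telescope_partial (f : ℤ → ℤ) (x : ℤ) {μ : ℕ → ℕ}
    (hμ : ∀ r, 1 ≤ r → μ (r + 1) ≤ μ r) {a : ℕ} (ha : a = 0 ∨ μ (a + 1) < μ a)
    {b : ℕ} (hab : a ≤ b) :
    ∑ r ∈ Finset.Ioc a b, (f (x - r + 1) - f (x - r) + f (x - r + μ r) - f (x - r + μ r + 1))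
      = f (x - a) - f (x - b)
        - ∑ r ∈ Finset.Ioc a b, (if r = 1 ∨ μ r < μ (r - 1) then f (x - r + μ r + 1) else 0)
        + ∑ r ∈ Finset.Ioc a b, (if μ (r + 1) < μ r then f (x - r + μ r) else 0)
        + (if b = 0 ∨ μ (b + 1) < μ b then 0 else f (x - b + μ b)) := by
  induction b, hab using Nat.le_induction with
  | base => simp [ha]
  | succ b hab ih =>
    simp only [Finset.sum_Ioc_succ_top hab, ih, Nat.add_sub_cancel, Nat.add_eq_right,
      Nat.add_eq_zero_iff, one_ne_zero, and_false, false_or]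
    push_cast
    rw [show x - ((b : ℤ) + 1) + 1 = x - b by ring]
    by_cases h : b = 0 ∨ μ (b + 1) < μ b
    · simp only [h, if_true]; split_ifs <;> ring
    · have : μ (b + 1) = μ b := by
        have := hμ b (by omega); omega
      simp only [this]
      rw [show x - ((b : ℤ) + 1) + μ b + 1 = x - b + μ b by ring]
      split_ifs <;> ring

theorem sum_rows_telescope (f : ℤ → ℤ) (x : ℤ) {μ : ℕ → ℕ} {n : ℕ}
    (hμ : ∀ r, 1 ≤ r → μ (r + 1) ≤ μ r) (hn : ∀ r, n < r → μ r = 0) {a : ℕ}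
    (ha : a = 0 ∨ μ (a + 1) < μ a) :
    ∑ r ∈ Finset.Ioc a (n + 1), ∑ c ∈ Finset.Icc 1 (μ r),
        (2 * f (x + c - r) - f (x + c - r - 1) - f (x + c - r + 1))
      = f (x - a)
        - ∑ r ∈ Finset.Ioc a (n + 1), (if r = 1 ∨ μ r < μ (r - 1) then f (x - r + μ r + 1) else 0)
        + ∑ r ∈ Finset.Ioc a (n + 1), (if μ (r + 1) < μ r then f (x - r + μ r) else 0) := by
  have han : a ≤ n + 1 := by
    by_contra h
    rcases ha with h' | h'
    · omega
    · rw [hn a (by omega)] at h'; omega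
  have key := sum_rows_telescope_partial f x hμ ha han
  simp only [hn (n + 1) (by omega), hn (n + 1 + 1) (by omega), lt_irrefl, Nat.add_eq_zero_iff,
    one_ne_zero, and_false, or_false, if_false, Nat.cast_zero, add_zero] at key
  rw [show ∀ u v w z : ℤ, u - z - v + w + z = u - v + w by intros; ring] at key
  rw [← key]
  refine Finset.sum_congr rfl fun r _ => ?_
  rw [← sum_row_telescope]
  refine Finset.sum_congr rfl fun c _ => ?_
  rw [show x + (c : ℤ) - r = x - r + c by ring]

/-- The last row of component `t` that is not below the node `A`
(for `t` not before the component of `A`). -/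
def lastRow (A : MNode) (t : ℕ) : ℕ := if t = A.2.2 then A.1 else 0

theorem below_iff_lastRow {A y : MNode} (hy : 1 ≤ y.1) :
    Below A y ↔ A.2.2 ≤ y.2.2 ∧ lastRow A y.2.2 < y.1 := by
  unfold Below lastRow; split_ifs <;> omega

/-- The rows `(t, r)` below the node `A`, including the first empty row of each component. -/
def rowsBelow (l n : ℕ) (A : MNode) : Finset (Σ _ : ℕ, ℕ) :=
  (Finset.Icc A.2.2 l).sigma fun t => Finset.Ioc (lastRow A t) (n + 1)

theorem sum_rowsBelow {l n : ℕ} {A : MNode} (g : ℕ → ℕ → ℤ) :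
    ∑ p ∈ rowsBelow l n A, g p.1 p.2
      = ∑ t ∈ Finset.Icc A.2.2 l, ∑ r ∈ Finset.Ioc (lastRow A t) (n + 1), g t r := by
  rw [rowsBelow, Finset.sum_sigma]

theorem mem_rowsBelow {l n : ℕ} {A : MNode} {p : Σ _ : ℕ, ℕ} :
    p ∈ rowsBelow l n A ↔ (A.2.2 ≤ p.1 ∧ p.1 ≤ l) ∧ lastRow A p.1 < p.2 ∧ p.2 ≤ n + 1 := by
  simp [rowsBelow]

section Diagram

variable {l n : ℕ} {μ : ℕ → ℕ → ℕ} {A : MNode}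

theorem ncard_addBelow (resN : MNode → ℕ) (i : ℕ)
    (hn : ∀ t ∈ Finset.Icc 1 l, ∀ r, n < r → μ t r = 0) (hA : 1 ≤ A.2.2) :
    (addBelow l resN (diag l μ) i A).ncard
      = ((rowsBelow l n A).filter fun p => resN (p.2, μ p.1 p.2 + 1, p.1) = i ∧
          (p.2 = 1 ∨ μ p.1 p.2 < μ p.1 (p.2 - 1))).card := by
  have hinj : Function.Injective
      fun p : (Σ _ : ℕ, ℕ) => ((p.2, μ p.1 p.2 + 1, p.1) : MNode) := by
    rintro ⟨t, r⟩ ⟨t', r'⟩ h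
    simp only [Prod.mk.injEq] at h
    obtain ⟨rfl, -, rfl⟩ := h
    rfl
  rw [← Finset.card_image_of_injective _ hinj, ← Set.ncard_coe_finset]
  congr 1
  ext ⟨r, c, t⟩
  simp only [Finset.coe_image, Set.mem_image, Finset.mem_coe, Finset.mem_filter, mem_rowsBelow,
    Sigma.exists, Prod.mk.injEq]
  constructor
  · rintro ⟨h1, h2, h3, h4, h5, h6, h7, h8, h9⟩
    rw [below_iff_lastRow h1] at h9
    simp only [diag, Set.mem_ofPred_eq] at h1 h2 h3 h4 h5 h7 h8 h9
    have ht : t ∈ Finset.Icc 1 l := by simp; omega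
    have hc : c = μ t r + 1 := by omega
    have hr : r ≤ n + 1 := by
      by_contra hr
      have := hn t ht (r - 1) (by omega)
      omega
    subst hc
    exact ⟨t, r, ⟨⟨⟨h9.1, h4⟩, h9.2, hr⟩, h6, by omega⟩, rfl, rfl, rfl⟩
  · rintro ⟨t', r', ⟨⟨⟨h1, h2⟩, h3, h4⟩, h5, h6⟩, rfl, rfl, rfl⟩
    have hr : 1 ≤ r' := by omega
    refine ⟨hr, by simp, by simp only; omega, h2, ?_, h5, ?_, ?_,
      (below_iff_lastRow hr).2 ⟨h1, h3⟩⟩ <;> simp only [diag, Set.mem_ofPred_eq] <;> omega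

theorem ncard_remBelow (resN : MNode → ℕ) (i : ℕ)
    (hn : ∀ t ∈ Finset.Icc 1 l, ∀ r, n < r → μ t r = 0) (hA : 1 ≤ A.2.2) :
    (remBelow resN (diag l μ) i A).ncard
      = ((rowsBelow l n A).filter fun p => resN (p.2, μ p.1 p.2, p.1) = i ∧
          μ p.1 (p.2 + 1) < μ p.1 p.2).card := by
  have hinj : Function.Injective
      fun p : (Σ _ : ℕ, ℕ) => ((p.2, μ p.1 p.2, p.1) : MNode) := by
    rintro ⟨t, r⟩ ⟨t', r'⟩ h
    simp only [Prod.mk.injEq] at h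
    obtain ⟨rfl, -, rfl⟩ := h
    rfl
  rw [← Finset.card_image_of_injective _ hinj, ← Set.ncard_coe_finset]
  congr 1
  ext ⟨r, c, t⟩
  simp only [Finset.coe_image, Set.mem_image, Finset.mem_coe, Finset.mem_filter, mem_rowsBelow,
    Sigma.exists, Prod.mk.injEq]
  constructor
  · rintro ⟨⟨h1, h2, h3, h4, h5⟩, h6, h7, h8, h9⟩
    rw [below_iff_lastRow h1] at h9
    simp only [diag, Set.mem_ofPred_eq] at h1 h2 h3 h4 h5 h7 h8 h9
    have ht : t ∈ Finset.Icc 1 l := by simp; omega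
    have hc : c = μ t r := by omega
    have hr : r ≤ n + 1 := by
      by_contra hr
      have := hn t ht r (by omega)
      omega
    subst hc
    exact ⟨t, r, ⟨⟨⟨h9.1, h4⟩, h9.2, hr⟩, h6, by omega⟩, rfl, rfl, rfl⟩
  · rintro ⟨t', r', ⟨⟨⟨h1, h2⟩, h3, h4⟩, h5, h6⟩, rfl, rfl, rfl⟩
    have hr : 1 ≤ r' := by omega
    refine ⟨⟨hr, ?_, ?_, h2, le_rfl⟩, h5, ?_, ?_,
      (below_iff_lastRow hr).2 ⟨h1, h3⟩⟩ <;> simp only [diag, Set.mem_ofPred_eq] <;> omega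

theorem sum_filter_below (g : MNode → ℤ) {D : Finset MNode} (hD : ∀ y, y ∈ D ↔ y ∈ diag l μ)
    (hn : ∀ t ∈ Finset.Icc 1 l, ∀ r, n < r → μ t r = 0) (hA : 1 ≤ A.2.2)
    [DecidablePred (Below A)] :
    ∑ y ∈ D with Below A y, g y
      = ∑ p ∈ rowsBelow l n A, ∑ c ∈ Finset.Icc 1 (μ p.1 p.2), g (p.2, c, p.1) := by
  rw [Finset.sum_sigma']
  refine Finset.sum_bij' (fun y _ => ⟨⟨y.2.2, y.1⟩, y.2.1⟩) (fun q _ => (q.1.2, q.2, q.1.1))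
    ?_ ?_ ?_ ?_ ?_
  · rintro ⟨r, c, t⟩ hy
    simp only [Finset.mem_filter, hD] at hy
    obtain ⟨⟨h1, h2, h3, h4, h5⟩, h6⟩ := hy
    rw [below_iff_lastRow h1] at h6
    simp only at h1 h2 h3 h4 h5 h6
    simp only [Finset.mem_sigma, mem_rowsBelow, Finset.mem_Icc]
    refine ⟨⟨⟨h6.1, h4⟩, h6.2, ?_⟩, h2, h5⟩
    by_contra hr
    have := hn t (by simp; omega) r (by omega)
    omega
  · rintro ⟨⟨t, r⟩, c⟩ hq
    simp only [Finset.mem_sigma, mem_rowsBelow, Finset.mem_Icc] at hq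
    obtain ⟨⟨⟨h1, h2⟩, h3, h4⟩, h5, h6⟩ := hq
    have hr : 1 ≤ r := by omega
    simp only [Finset.mem_filter, hD]
    exact ⟨⟨hr, h5, by simp only; omega, h2, h6⟩, (below_iff_lastRow hr).2 ⟨h1, h3⟩⟩
  · simp
  · simp
  · simp

theorem mul_ite_and (a : ℤ) (p q : Prop) [Decidable p] [Decidable q] :
    (a * if p ∧ q then 1 else 0) = if q then (if p then a else 0) else 0 := by
  by_cases p <;> by_cases q <;> simp [*]

/-- `d_A` of a diagram in terms of the bilinear form: up to a term depending only on `A`, it is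
minus the pairing of `α_{res A}` with the content of the part of the diagram below `A`. -/
theorem dA_diag {κ : ℕ → ℤ} {res : ℤ → ℕ} {B : ℕ → ℕ → ℤ}
    (hB : ∀ k, B (resNode res κ A) (res k) = 2 * resWeight B res (resNode res κ A) k
      - resWeight B res (resNode res κ A) (k - 1) - resWeight B res (resNode res κ A) (k + 1))
    (hμ : ∀ t ∈ Finset.Icc 1 l, ∀ r, 1 ≤ r → μ t (r + 1) ≤ μ t r)
    (hn : ∀ t ∈ Finset.Icc 1 l, ∀ r, n < r → μ t r = 0) (hA : 1 ≤ A.2.2)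
    (hrem : μ A.2.2 (A.1 + 1) < μ A.2.2 A.1)
    {D : Finset MNode} (hD : ∀ y, y ∈ D ↔ y ∈ diag l μ) [DecidablePred (Below A)] :
    dA l B (resNode res κ) (diag l μ) A
      = ∑ t ∈ Finset.Icc A.2.2 l, resWeight B res (resNode res κ A) (κ t - lastRow A t)
        - ∑ y ∈ D with Below A y, B (resNode res κ A) (resNode res κ y) := by
  set i := resNode res κ A with hi
  rw [dA, ← hi, ncard_addBelow _ _ hn hA, ncard_remBelow _ _ hn hA, sum_filter_below _ hD hn hA,
    Finset.card_filter, Finset.card_filter, mul_sub]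
  push_cast
  rw [Finset.mul_sum, Finset.mul_sum]
  have h0 : ∑ p ∈ rowsBelow l n A, ∑ c ∈ Finset.Icc 1 (μ p.1 p.2),
      B i (resNode res κ (p.2, c, p.1))
      = ∑ t ∈ Finset.Icc A.2.2 l, resWeight B res i (κ t - lastRow A t)
        - ∑ p ∈ rowsBelow l n A, (if p.2 = 1 ∨ μ p.1 p.2 < μ p.1 (p.2 - 1) then
          resWeight B res i (κ p.1 - p.2 + μ p.1 p.2 + 1) else 0)
        + ∑ p ∈ rowsBelow l n A, (if μ p.1 (p.2 + 1) < μ p.1 p.2 then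
          resWeight B res i (κ p.1 - p.2 + μ p.1 p.2) else 0) := by
    simp only [resNode, hB]
    rw [sum_rowsBelow (fun t r => ∑ c ∈ Finset.Icc 1 (μ t r), (2 * resWeight B res i (κ t + c - r)
        - resWeight B res i (κ t + c - r - 1) - resWeight B res i (κ t + c - r + 1))),
      sum_rowsBelow (fun t r => if r = 1 ∨ μ t r < μ t (r - 1) then
        resWeight B res i (κ t - r + μ t r + 1) else 0),
      sum_rowsBelow (fun t r => if μ t (r + 1) < μ t r then
        resWeight B res i (κ t - r + μ t r) else 0),
      ← Finset.sum_sub_distrib, ← Finset.sum_add_distrib]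
    refine Finset.sum_congr rfl fun t ht => ?_
    have ht' : t ∈ Finset.Icc 1 l := by simp only [Finset.mem_Icc] at ht ⊢; omega
    exact sum_rows_telescope (resWeight B res i) (κ t) (hμ t ht') (hn t ht')
      (by unfold lastRow; split_ifs with h <;> simp [h, hrem])
  have h1 : ∀ p ∈ rowsBelow l n A, (B i i / 2 * if resNode res κ (p.2, μ p.1 p.2 + 1, p.1) = i ∧
      (p.2 = 1 ∨ μ p.1 p.2 < μ p.1 (p.2 - 1)) then 1 else 0)
      = if p.2 = 1 ∨ μ p.1 p.2 < μ p.1 (p.2 - 1) then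
        resWeight B res i (κ p.1 - p.2 + μ p.1 p.2 + 1) else 0 := by
    intro p _
    rw [resWeight, resNode, show κ p.1 - p.2 + μ p.1 p.2 + 1
      = κ p.1 + ((μ p.1 p.2 + 1 : ℕ) : ℤ) - p.2 by push_cast; ring]
    exact mul_ite_and _ _ _
  have h2 : ∀ p ∈ rowsBelow l n A, (B i i / 2 * if resNode res κ (p.2, μ p.1 p.2, p.1) = i ∧
      μ p.1 (p.2 + 1) < μ p.1 p.2 then 1 else 0)
      = if μ p.1 (p.2 + 1) < μ p.1 p.2 then
        resWeight B res i (κ p.1 - p.2 + μ p.1 p.2) else 0 := by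
    intro p _
    rw [resWeight, resNode, show κ p.1 - p.2 + μ p.1 p.2 = κ p.1 + (μ p.1 p.2 : ℤ) - p.2 by ring]
    exact mul_ite_and _ _ _
  rw [Finset.sum_congr rfl h1, Finset.sum_congr rfl h2, h0]
  ring

end Diagram

theorem exists_le_iff_of_downward {P : ℕ → Prop} {n : ℕ} (hP : ∀ c, 1 ≤ c → P (c + 1) → P c)
    (hn : ∀ c, P c → c ≤ n) : ∃ m, ∀ c, 1 ≤ c → (c ≤ m ↔ P c) := by
  classical
  have hdown : ∀ a b, 1 ≤ a → a ≤ b → P b → P a := by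
    intro a b ha hab
    induction b, hab using Nat.le_induction with
    | base => exact id
    | succ b hb ih => exact fun h => ih (hP b (by omega) h)
  refine ⟨Nat.findGreatest P n, fun c hc => ⟨fun h => ?_, fun h => Nat.le_findGreatest (hn c h) h⟩⟩
  exact hdown c _ hc h (Nat.findGreatest_of_ne_zero rfl (by omega))

section Tableau

variable {l n : ℕ} {lam : ℕ → ℕ → ℕ}

theorem MP.IsMP.row_le (hMP : IsMP l n lam) {t r c : ℕ} (hc : 1 ≤ c) (h : c ≤ lam t r) : r ≤ n := by
  by_contra hr
  have := hMP.2.1 t r (by omega)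
  omega

theorem mem_diagF (hMP : IsMP l n lam) (x : MNode) : x ∈ diagF l n lam ↔ x ∈ diag l lam := by
  obtain ⟨r, c, t⟩ := x
  simp only [diagF, diag, Finset.mem_filter, Finset.mem_product, Finset.mem_Icc, Set.mem_ofPred_eq]
  have h1 := hMP.2.2.1 t r
  constructor
  · omega
  · rintro ⟨h2, h3, h4, h5, h6⟩
    have := hMP.row_le h3 h6
    omega

/-- The subdiagram of the entries `≤ T A` of a tableau `T` increasing along rows and columns. -/
theorem exists_diag_eq_subtableau (hMP : IsMP l n lam) {T : MNode → ℕ} (hrow : RowStrict l lam T)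
    (hcol : ColStrict l lam T) {A : MNode} (hA : A ∈ diag l lam) :
    ∃ μ : ℕ → ℕ → ℕ, {y | y ∈ diag l lam ∧ T y ≤ T A} = diag l μ ∧
      (∀ t ∈ Finset.Icc 1 l, ∀ r, 1 ≤ r → μ t (r + 1) ≤ μ t r) ∧
      (∀ t ∈ Finset.Icc 1 l, ∀ r, n < r → μ t r = 0) ∧
      μ A.2.2 (A.1 + 1) < μ A.2.2 A.1 := by
  have key : ∀ t r, ∃ m, ∀ c, 1 ≤ c → (c ≤ m ↔ (r, c, t) ∈ diag l lam ∧ T (r, c, t) ≤ T A) := by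
    intro t r
    refine exists_le_iff_of_downward (n := n) (fun c hc h => ?_) fun c h => ?_
    · have hd : (r, c, t) ∈ diag l lam := by
        obtain ⟨⟨h1, h2, h3, h4, h5⟩, h6⟩ := h
        exact ⟨h1, hc, h3, h4, by simp only at h5 ⊢; omega⟩
      exact ⟨hd, (hrow r c t hd h.1).le.trans h.2⟩
    · exact h.1.2.2.2.2.trans (hMP.2.2.1 t r)
  choose μ hμ using key
  have hup : ∀ t r c, 1 ≤ r → (r + 1, c, t) ∈ diag l lam → (r, c, t) ∈ diag l lam := by
    rintro t r c hr ⟨h1, h2, h3, h4, h5⟩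
    exact ⟨hr, h2, h3, h4, h5.trans (hMP.1 t r hr)⟩
  refine ⟨μ, ?_, fun t ht r hr => ?_, fun t ht r hr => ?_, ?_⟩
  · ext ⟨r, c, t⟩
    constructor
    · rintro ⟨h, h'⟩
      exact ⟨h.1, h.2.1, h.2.2.1, h.2.2.2.1, (hμ t r c h.2.1).2 ⟨h, h'⟩⟩
    · rintro ⟨h1, h2, h3, h4, h5⟩
      exact (hμ t r c h2).1 h5
  · rcases Nat.eq_zero_or_pos (μ t (r + 1)) with h | h
    · omega
    · have h' := (hμ t (r + 1) _ h).1 le_rfl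
      have hd := hup t r _ hr h'.1
      exact (hμ t r _ h).2 ⟨hd, (hcol r _ t hd h'.1).le.trans h'.2⟩
  · by_contra h
    have h' := (hμ t r 1 le_rfl).1 (by omega)
    have := hMP.row_le le_rfl h'.1.2.2.2.2
    omega
  · obtain ⟨r, c, t⟩ := A
    have h1 : c ≤ μ t r := (hμ t r c hA.2.1).2 ⟨hA, le_rfl⟩
    have h2 : ¬ c ≤ μ t (r + 1) := fun h => by
      have h' := (hμ t (r + 1) c hA.2.1).1 h
      exact absurd (hcol r c t hA h'.1) (by omega)
    simp only
    omega

theorem itab_lt_of_below (hMP : IsMP l n lam) {x y : MNode} (hx : x ∈ diag l lam)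
    (hy : y ∈ diag l lam) (h : Below x y) : itab n lam x < itab n lam y := by
  obtain ⟨r, c, t⟩ := x
  obtain ⟨r', c', t'⟩ := y
  obtain ⟨h1, h2, h3, h4, h5⟩ := hx
  obtain ⟨h1', h2', h3', h4', h5'⟩ := hy
  simp only at h1 h2 h3 h4 h5 h1' h2' h3' h4' h5'
  have hr := hMP.row_le h2 h5
  have hs := Finset.sum_Ico_succ_top h1 (lam t)
  simp only [itab]
  rcases h with h | ⟨h, h'⟩
  · simp only at h
    have ha : ∑ r' ∈ Finset.Ico 1 (r + 1), lam t r' ≤ ∑ r' ∈ Finset.Icc 1 n, lam t r' :=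
      Finset.sum_le_sum_of_subset fun z hz => by simp only [Finset.mem_Ico, Finset.mem_Icc] at *; omega
    have hb : ∑ t'' ∈ Finset.Ico 1 (t + 1), ∑ r' ∈ Finset.Icc 1 n, lam t'' r'
        ≤ ∑ t'' ∈ Finset.Ico 1 t', ∑ r' ∈ Finset.Icc 1 n, lam t'' r' :=
      Finset.sum_le_sum_of_subset fun z hz => by simp only [Finset.mem_Ico] at *; omega
    rw [Finset.sum_Ico_succ_top h3] at hb
    omega
  · simp only at h h'
    subst h
    have ha : ∑ r'' ∈ Finset.Ico 1 (r + 1), lam t r'' ≤ ∑ r'' ∈ Finset.Ico 1 r', lam t r'' :=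
      Finset.sum_le_sum_of_subset fun z hz => by simp only [Finset.mem_Ico] at *; omega
    omega

theorem itab_rowStrict : RowStrict l lam (itab n lam) := fun r c t _ _ => by simp [itab]

theorem itab_colStrict (hMP : IsMP l n lam) : ColStrict l lam (itab n lam) :=
  fun _ _ _ h h' => itab_lt_of_below hMP h h' (Or.inr ⟨rfl, Nat.lt_succ_self _⟩)

theorem MP.RowStrict.lt_of_lt {T : MNode → ℕ} (hrow : RowStrict l lam T) {r c c' t : ℕ}
    (hc : (r, c, t) ∈ diag l lam) (hlt : c < c') (hc' : (r, c', t) ∈ diag l lam) :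
    T (r, c, t) < T (r, c', t) := by
  induction c', hlt using Nat.le_induction with
  | base => exact hrow r c t hc hc'
  | succ b hb ih =>
    have hd : (r, b, t) ∈ diag l lam :=
      ⟨hc.1, hc.2.1.trans (by simp only; omega), hc.2.2.1, hc.2.2.2.1,
        (Nat.le_succ b).trans hc'.2.2.2.2⟩
    exact (ih hd).trans (hrow r b t hd hc')

theorem itab_lt_and_lt_iff (hMP : IsMP l n lam) {T : MNode → ℕ} (hinj : Set.InjOn T (diag l lam))
    (hrow : RowStrict l lam T) {x y : MNode} (hx : x ∈ diag l lam) (hy : y ∈ diag l lam) :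
    itab n lam x < itab n lam y ∧ T y < T x ↔ T y ≤ T x ∧ Below x y := by
  obtain ⟨r, c, t⟩ := x
  obtain ⟨r', c', t'⟩ := y
  constructor
  · rintro ⟨h, h'⟩
    refine ⟨h'.le, ?_⟩
    by_contra hb
    by_cases hb' : Below (r', c', t') (r, c, t)
    · exact absurd (itab_lt_of_below hMP hy hx hb') (by omega)
    · simp only [Below] at hb hb'
      obtain rfl : t = t' := by omega
      obtain rfl : r = r' := by omega
      have hc : c < c' := by simpa [itab] using h
      exact absurd (hrow.lt_of_lt hx hc hy) (by omega)
  · rintro ⟨h, hb⟩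
    refine ⟨itab_lt_of_below hMP hx hy hb, h.lt_of_ne fun he => ?_⟩
    have := hinj hy hx he
    simp only [Prod.mk.injEq] at this
    simp only [Below] at hb
    omega

/-- The degree of a tableau increasing along rows and columns in terms of the bilinear form. -/
theorem degT_eq (hMP : IsMP l n lam) {κ : ℕ → ℤ} {res : ℤ → ℕ} {B : ℕ → ℕ → ℤ}
    (hB : ∀ j k, B (res j) (res k) = 2 * resWeight B res (res j) k
      - resWeight B res (res j) (k - 1) - resWeight B res (res j) (k + 1))
    {T : MNode → ℕ} (hrow : RowStrict l lam T) (hcol : ColStrict l lam T)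
    [∀ A, DecidablePred (Below A)] :
    degT l n lam B (resNode res κ) T
      = ∑ x ∈ diagF l n lam,
          ∑ t ∈ Finset.Icc x.2.2 l, resWeight B res (resNode res κ x) (κ t - lastRow x t)
        - ∑ x ∈ diagF l n lam, ∑ y ∈ diagF l n lam,
          if T y ≤ T x ∧ Below x y then B (resNode res κ x) (resNode res κ y) else 0 := by
  rw [degT, ← Finset.sum_sub_distrib]
  refine Finset.sum_congr rfl fun x hx => ?_
  rw [mem_diagF hMP] at hx
  obtain ⟨μ, hS, hμ, hn, hrem⟩ := exists_diag_eq_subtableau hMP hrow hcol hx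
  rw [hS, dA_diag (D := (diagF l n lam).filter fun y => T y ≤ T x) (fun k => hB _ k) hμ hn
    hx.2.2.1 hrem fun y => by simp [← hS, mem_diagF hMP], Finset.filter_filter, Finset.sum_filter]

end Tableau

/-- In type `C_∞` or `C^(1)_ℓ`, for every standard `λ`-tableau `T`,
`−Σ (α_{ν_a}, α_{ν_b})` — summed over the pairs `1 ≤ a < b ≤ n` with
`w^T(a) > w^T(b)`, with `ν = res t^λ` — equals `deg T − deg t^λ`.
(The left side is the homogeneous degree of `ψ_{w^T} e(res t^λ)`.) -/
theorem stmt12 (l n : ℕ) (hl : 1 ≤ l) (lam : ℕ → ℕ → ℕ) (hMP : IsMP l n lam)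
    (κ : ℕ → ℤ) (res : ℤ → ℕ) (B : ℕ → ℕ → ℤ)
    (htype : (res = fun z => z.natAbs) ∧ B = BInf ∨
             (∃ L : ℕ, 2 ≤ L ∧ res = resAff L ∧ B = BAff L))
    (T : MNode → ℕ) (hT : IsStd l n lam T)
    (w : Equiv.Perm ℕ) (hw : PermOf l n lam T w)
    (ν : ℕ → ℕ) (hν : ∀ x ∈ diag l lam, ν (itab n lam x) = resNode res κ x) :
    -(∑ p ∈ ((Finset.Icc 1 n) ×ˢ (Finset.Icc 1 n)).filter
        (fun p => p.1 < p.2 ∧ w p.2 < w p.1), B (ν p.1) (ν p.2))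
      = degT l n lam B (resNode res κ) T - degT l n lam B (resNode res κ) (itab n lam) := by
  classical
  obtain ⟨hTab, hrow, hcol⟩ := hT
  obtain ⟨hfix, hwT⟩ := hw
  have hB : ∀ j k, B (res j) (res k) = 2 * resWeight B res (res j) k
      - resWeight B res (res j) (k - 1) - resWeight B res (res j) (k + 1) := by
    rcases htype with ⟨rfl, rfl⟩ | ⟨L, hL, rfl, rfl⟩
    · exact fun j k => BInf_eq_resWeight _ k
    · exact fun j k => BAff_eq_resWeight hL (resAff_le hL j) k
  have hitab : Set.BijOn (itab n lam) (diagF l n lam) (Finset.Icc 1 n) := by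
    have hD : (diagF l n lam : Set MNode) = diag l lam := Set.ext fun x => mem_diagF hMP x
    have hw' : Set.BijOn w.symm (Set.Icc 1 n) (Set.Icc 1 n) := by
      have hmaps : ∀ m, w m ∈ Set.Icc 1 n → m ∈ Set.Icc 1 n := fun m hm => by
        by_contra h
        exact h (hfix m h ▸ hm)
      have hsymm : Set.MapsTo w.symm (Set.Icc 1 n) (Set.Icc 1 n) := fun m hm =>
        hmaps _ (by simpa using hm)
      exact ⟨hsymm, w.symm.injective.injOn,
        Finset.surjOn_of_injOn_of_card_le (s := Finset.Icc 1 n) (t := Finset.Icc 1 n) w.symm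
          (by simpa using hsymm) w.symm.injective.injOn le_rfl |>.mono (by simp) (by simp)⟩
    rw [hD, Finset.coe_Icc]
    exact (hw'.comp hTab).congr fun x hx => by simp [← hwT x hx]
  have himage : Finset.Icc 1 n = (diagF l n lam).image (itab n lam) := by
    rw [← Finset.coe_inj, Finset.coe_image, hitab.image_eq]
  have hzero : ∑ x ∈ diagF l n lam, ∑ y ∈ diagF l n lam,
      (if itab n lam y ≤ itab n lam x ∧ Below x y then
        B (resNode res κ x) (resNode res κ y) else 0) = 0 :=
    Finset.sum_eq_zero fun x hx => Finset.sum_eq_zero fun y hy => if_neg fun h =>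
      h.1.not_gt (itab_lt_of_below hMP ((mem_diagF hMP x).1 hx) ((mem_diagF hMP y).1 hy) h.2)
  rw [degT_eq hMP hB hrow hcol, degT_eq hMP hB itab_rowStrict (itab_colStrict hMP), hzero,
    Finset.sum_filter, Finset.sum_product, himage, Finset.sum_image hitab.injOn, sub_zero,
    sub_sub_cancel_left]
  congr 1
  refine Finset.sum_congr rfl fun x hx => ?_
  rw [Finset.sum_image hitab.injOn]
  refine Finset.sum_congr rfl fun y hy => ?_
  rw [mem_diagF hMP] at hx hy
  simp only [hν x hx, hν y hy, hwT x hx, hwT y hy,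
    itab_lt_and_lt_iff hMP hTab.injOn hrow hx hy]
end

section
/- Let Λ and Λ' be dominant integral weights, β, β' ∈ Q^+, M a finite-dimensional R^Λ(β)-module, and N a finite-dimensional R^{Λ'}(β')-module (viewed as modules over R(β) and R(β') via the quotient maps). Then for every ν ∈ I^{β+β'}, the element x_1^{⟨α_{ν_1}^∨, Λ+Λ'⟩} e(ν) annihilates the convolution product M∘N; hence the R(β+β')-module M∘N factors through the cyclotomic quotient R^{Λ+Λ'}(β+β'). -/
namespace S15

/-- Generators of the quiver Hecke algebra `R(β)` (with `β` of height `n`, encoded by a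
sequence `ν₀ ∈ I^n`): idempotents `e(ν)`, polynomial generators `x_1, …, x_n` and
intertwiners `ψ_1, …, ψ_{n−1}` (1-based; out-of-range generators are `0`). -/
inductive Gen (I : Type) (n : ℕ) : Type
  | e : (Fin n → I) → Gen I n
  | x : ℕ → Gen I n
  | p : ℕ → Gen I n

variable (k : Type) [Field k] (I : Type) [Fintype I] [DecidableEq I]

/-- The free algebra on the generators. -/
abbrev FA (k : Type) [Field k] (I : Type) (n : ℕ) : Type := FreeAlgebra k (Gen I n)

variable {n : ℕ}

def E (ν : Fin n → I) : FA k I n := FreeAlgebra.ι k (Gen.e ν)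
def X (r : ℕ) : FA k I n := FreeAlgebra.ι k (Gen.x r)
def P (r : ℕ) : FA k I n := FreeAlgebra.ι k (Gen.p r)

/-- The finite set `I^β`: all sequences with the same content as `ν₀`. -/
def cls (ν₀ : Fin n → I) : Finset (Fin n → I) :=
  Finset.image (fun σ : Equiv.Perm (Fin n) => ν₀ ∘ σ) Finset.univ

/-- `s_r ν`: exchange the entries of `ν` at 1-based positions `r` and `r + 1`. -/
def swapAt (ν : Fin n → I) (r : ℕ) (h1 : 1 ≤ r) (h2 : r + 1 ≤ n) : Fin n → I :=
  fun m =>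
    if (m : ℕ) + 1 = r then ν ⟨r, by omega⟩
    else if (m : ℕ) + 1 = r + 1 then ν ⟨r - 1, by omega⟩
    else ν m

/-- Evaluation of `Q_{i,j}(u, v) = Σ t_{i,j;p,q} u^p v^q` (the summation range is a
bound for the support of the coefficients, valid under the hypotheses of the theorem). -/
def Qev (a : I → I → ℤ) (d : I → ℤ) (t : I → I → ℕ → ℕ → k) (i j : I)
    (u v : FA k I n) : FA k I n :=
  ∑ p ∈ Finset.range ((d i * a i j).natAbs + 1),
    ∑ q ∈ Finset.range ((d i * a i j).natAbs + 1),
      (t i j p q) • (u ^ p * v ^ q)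

/-- Evaluation of the divided difference
`(Q_{i,j}(u,v) − Q_{i,j}(w,v))/(u − w) = Σ_{p,q} t_{i,j;p,q} (Σ_{m<p} u^m w^{p−1−m}) v^q`. -/
def DDev (a : I → I → ℤ) (d : I → ℤ) (t : I → I → ℕ → ℕ → k) (i j : I)
    (u w v : FA k I n) : FA k I n :=
  ∑ p ∈ Finset.range ((d i * a i j).natAbs + 1),
    ∑ q ∈ Finset.range ((d i * a i j).natAbs + 1),
      (t i j p q) • ((∑ m ∈ Finset.range p, u ^ m * w ^ (p - 1 - m)) * v ^ q)

/-- The defining relations of the quiver Hecke algebra `R(β)` (`useCyc = False`),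
resp. of the cyclotomic quiver Hecke algebra `R^Λ(β)` (`useCyc = True`). -/
inductive Rel (a : I → I → ℤ) (d : I → ℤ) (t : I → I → ℕ → ℕ → k)
    (useCyc : Prop) (Λ : I → ℕ) (n : ℕ) (ν₀ : Fin n → I) :
    FA k I n → FA k I n → Prop
  | idem (ν ν' : Fin n → I) :
      Rel a d t useCyc Λ n ν₀ (E k I ν * E k I ν') (if ν = ν' then E k I ν else 0)
  | support (ν : Fin n → I) (h : ν ∉ cls I ν₀) : Rel a d t useCyc Λ n ν₀ (E k I ν) 0
  | total : Rel a d t useCyc Λ n ν₀ (∑ ν ∈ cls I ν₀, E k I ν) 1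
  | xzero (r : ℕ) (h : r = 0 ∨ n < r) : Rel a d t useCyc Λ n ν₀ (X k I r) 0
  | pzero (r : ℕ) (h : r = 0 ∨ n ≤ r) : Rel a d t useCyc Λ n ν₀ (P k I r) 0
  | xe (r : ℕ) (ν : Fin n → I) :
      Rel a d t useCyc Λ n ν₀ (X k I r * E k I ν) (E k I ν * X k I r)
  | pe (r : ℕ) (h1 : 1 ≤ r) (h2 : r + 1 ≤ n) (ν : Fin n → I) :
      Rel a d t useCyc Λ n ν₀ (P k I r * E k I ν)
        (E k I (swapAt I ν r h1 h2) * P k I r)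
  | xx (r s : ℕ) : Rel a d t useCyc Λ n ν₀ (X k I r * X k I s) (X k I s * X k I r)
  | px (r s : ℕ) (h : s ≠ r) (h' : s ≠ r + 1) :
      Rel a d t useCyc Λ n ν₀ (P k I r * X k I s) (X k I s * P k I r)
  | pp (r s : ℕ) (h : r + 1 < s) :
      Rel a d t useCyc Λ n ν₀ (P k I r * P k I s) (P k I s * P k I r)
  | xp (r : ℕ) (h1 : 1 ≤ r) (h2 : r + 1 ≤ n) (ν : Fin n → I) :
      Rel a d t useCyc Λ n ν₀ (X k I r * P k I r * E k I ν)
        (P k I r * X k I (r + 1) * E k I ν -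
          (if ν ⟨r - 1, by omega⟩ = ν ⟨r, by omega⟩ then E k I ν else 0))
  | px' (r : ℕ) (h1 : 1 ≤ r) (h2 : r + 1 ≤ n) (ν : Fin n → I) :
      Rel a d t useCyc Λ n ν₀ (X k I (r + 1) * P k I r * E k I ν)
        (P k I r * X k I r * E k I ν +
          (if ν ⟨r - 1, by omega⟩ = ν ⟨r, by omega⟩ then E k I ν else 0))
  | psq (r : ℕ) (h1 : 1 ≤ r) (h2 : r + 1 ≤ n) (ν : Fin n → I) :
      Rel a d t useCyc Λ n ν₀ (P k I r * P k I r * E k I ν)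
        (Qev k I a d t (ν ⟨r - 1, by omega⟩) (ν ⟨r, by omega⟩)
            (X k I r) (X k I (r + 1)) * E k I ν)
  | braid (r : ℕ) (h1 : 1 ≤ r) (h2 : r + 2 ≤ n) (ν : Fin n → I) :
      Rel a d t useCyc Λ n ν₀
        ((P k I (r + 1) * P k I r * P k I (r + 1) -
            P k I r * P k I (r + 1) * P k I r) * E k I ν)
        (if ν ⟨r - 1, by omega⟩ = ν ⟨r + 1, by omega⟩
         then DDev k I a d t (ν ⟨r - 1, by omega⟩) (ν ⟨r, by omega⟩)
                (X k I r) (X k I (r + 2)) (X k I (r + 1)) * E k I ν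
         else 0)
  | cyc (hc : useCyc) (h : 1 ≤ n) (ν : Fin n → I) :
      Rel a d t useCyc Λ n ν₀ (X k I 1 ^ (Λ (ν ⟨0, by omega⟩)) * E k I ν) 0

/-- The (cyclotomic, if `useCyc`) quiver Hecke algebra. -/
abbrev QHA (a : I → I → ℤ) (d : I → ℤ) (t : I → I → ℕ → ℕ → k)
    (useCyc : Prop) (Λ : I → ℕ) (n : ℕ) (ν₀ : Fin n → I) : Type :=
  RingQuot (Rel k I a d t useCyc Λ n ν₀)

def mkA (a : I → I → ℤ) (d : I → ℤ) (t : I → I → ℕ → ℕ → k)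
    (useCyc : Prop) (Λ : I → ℕ) (n : ℕ) (ν₀ : Fin n → I) :
    FA k I n →ₐ[k] QHA k I a d t useCyc Λ n ν₀ :=
  RingQuot.mkAlgHom k (Rel k I a d t useCyc Λ n ν₀)

end S15

namespace S15

section Span

variable {K A : Type*} [CommRing K] [Ring A] [Algebra K A]

theorem mul_mul_mem_of_mem_span {S : Set A} {L : Submodule K A} {u : A}
    (hu : u ∈ Submodule.span K S) (a b : A) (h : ∀ s ∈ S, a * s * b ∈ L) : a * u * b ∈ L := by
  induction hu using Submodule.span_induction with
  | mem s hs => exact h s hs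
  | zero => simp
  | add u v _ _ hu hv => simpa only [mul_add, add_mul] using L.add_mem hu hv
  | smul c u _ hu => simpa only [mul_smul_comm, smul_mul_assoc] using L.smul_mem c hu

/-- The consequences of the quiver Hecke relations that do not refer to the indexing of the
idempotents; the correction terms are only recorded up to the spans they lie in. -/
structure IsHeckeSystem (K : Type*) {A ι : Type*} [CommRing K] [Ring A] [Algebra K A]
    (e : ι → A) (x p : ℕ → A) : Prop where
  p_zero : p 0 = 0
  p_e : ∀ r ν, ∃ ν', p r * e ν = e ν' * p r
  x_e : ∀ r ν, Commute (x r) (e ν)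
  x_x : ∀ r s, Commute (x r) (x s)
  p_x : ∀ r s, s ≠ r → s ≠ r + 1 → Commute (p r) (x s)
  p_p : ∀ r s, r + 1 < s → Commute (p r) (p s)
  swap : ∀ r, ∃ τ ∈ Submodule.span K (Set.range e),
    p r * x (r + 1) = x r * p r + τ ∧ p r * x r = x (r + 1) * p r - τ
  sq : ∀ r, p r * p r ∈ Submodule.span K
    {z | ∃ a b ν, z = x r ^ a * x (r + 1) ^ b * e ν}
  braid : ∀ r, p r * p (r + 1) * p r - p (r + 1) * p r * p (r + 1) ∈ Submodule.span K
    {z | ∃ a b c ν, z = x r ^ a * x (r + 1) ^ b * x (r + 2) ^ c * e ν}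

/-- The product `p_a p_{a+1} ⋯ p_{a+l-1}`. -/
def chain (p : ℕ → A) (a : ℕ) : ℕ → A
  | 0 => 1
  | l + 1 => chain p a l * p (a + l)

theorem chain_add (p : ℕ → A) (a l l' : ℕ) :
    chain p a (l + l') = chain p a l * chain p (a + l) l' := by
  induction l' with
  | zero => simp [chain]
  | succ l' ih => rw [← add_assoc, chain, chain, ih, mul_assoc, add_assoc]

theorem chain_succ_left (p : ℕ → A) (a l : ℕ) :
    chain p a (l + 1) = p a * chain p (a + 1) l := by
  rw [add_comm, chain_add]; simp [chain]

theorem commute_chain {p : ℕ → A} {y : A} {a l : ℕ}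
    (h : ∀ s, a ≤ s → s < a + l → Commute y (p s)) : Commute y (chain p a l) := by
  induction l with
  | zero => exact Commute.one_right y
  | succ l ih =>
    exact (ih fun s h1 h2 => h s h1 (by omega)).mul_right (h _ (by omega) (by omega))

/-- The subalgebra generated by all generators other than `p_1`. -/
def tailSubalgebra (K : Type*) {A ι : Type*} [CommRing K] [Ring A] [Algebra K A]
    (e : ι → A) (x p : ℕ → A) : Subalgebra K A :=
  Algebra.adjoin K (Set.range e ∪ Set.range x ∪ p '' {r | r ≠ 1})

/-- The left module over `tailSubalgebra` generated by the products `p_1 ⋯ p_j`. -/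
def chainSpan (K : Type*) {A ι : Type*} [CommRing K] [Ring A] [Algebra K A]
    (e : ι → A) (x p : ℕ → A) : Submodule (tailSubalgebra K e x p) A :=
  Submodule.span _ (Set.range (chain p 1))

variable {ι : Type*} {e : ι → A} {x p : ℕ → A}

theorem e_mem_tail (ν : ι) : e ν ∈ tailSubalgebra K e x p :=
  Algebra.subset_adjoin (Or.inl (Or.inl ⟨ν, rfl⟩))

theorem x_mem_tail (r : ℕ) : x r ∈ tailSubalgebra K e x p :=
  Algebra.subset_adjoin (Or.inl (Or.inr ⟨r, rfl⟩))

theorem p_mem_tail {r : ℕ} (h : r ≠ 1) : p r ∈ tailSubalgebra K e x p :=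
  Algebra.subset_adjoin (Or.inr ⟨r, h, rfl⟩)

theorem chain_mem_tail {a : ℕ} (l : ℕ) (h : 2 ≤ a) : chain p a l ∈ tailSubalgebra K e x p := by
  induction l with
  | zero => exact one_mem _
  | succ l ih => exact mul_mem ih (p_mem_tail (by omega))

theorem mul_mem_chainSpan {a b : A} (ha : a ∈ tailSubalgebra K e x p)
    (hb : b ∈ chainSpan K e x p) : a * b ∈ chainSpan K e x p :=
  (chainSpan K e x p).smul_mem ⟨a, ha⟩ hb

theorem chain_mem_chainSpan (j : ℕ) : chain p 1 j ∈ chainSpan K e x p :=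
  Submodule.subset_span ⟨j, rfl⟩

theorem mul_right_mem_chainSpan {g u : A} (h : ∀ j, chain p 1 j * g ∈ chainSpan K e x p)
    (hu : u ∈ chainSpan K e x p) : u * g ∈ chainSpan K e x p := by
  unfold chainSpan at hu
  induction hu using Submodule.span_induction with
  | mem u hu => obtain ⟨j, rfl⟩ := hu; exact h j
  | zero => simp
  | add u v _ _ hu hv => rw [add_mul]; exact add_mem hu hv
  | smul c u _ hu =>
    rw [Subalgebra.smul_def, smul_eq_mul, mul_assoc]; exact mul_mem_chainSpan c.2 hu

namespace IsHeckeSystem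

variable (H : IsHeckeSystem K e x p)
include H

theorem chain_e (a l : ℕ) (ν : ι) : ∃ ν', chain p a l * e ν = e ν' * chain p a l := by
  induction l generalizing ν with
  | zero => exact ⟨ν, by simp [chain]⟩
  | succ l ih =>
    obtain ⟨ν₁, h₁⟩ := H.p_e (a + l) ν
    obtain ⟨ν₂, h₂⟩ := ih ν₁
    exact ⟨ν₂, by rw [chain, mul_assoc, h₁, ← mul_assoc, h₂, mul_assoc]⟩

theorem commute_x_chain {s a l : ℕ} (h : s < a ∨ a + l < s) :
    Commute (x s) (chain p a l) :=
  commute_chain fun r _ _ => (H.p_x r s (by omega) (by omega)).symm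

theorem commute_p_chain {s a l : ℕ} (h : s + 1 < a ∨ a + l < s) :
    Commute (p s) (chain p a l) :=
  commute_chain fun r _ _ => by
    rcases h with h | h
    · exact H.p_p s r (by omega)
    · exact (H.p_p r s (by omega)).symm

theorem commute_chain_chain {a l b l' : ℕ} (h : a + l < b) :
    Commute (chain p a l) (chain p b l') :=
  commute_chain fun r _ _ => (H.commute_p_chain (by omega)).symm

theorem chain_span_e_chain_mem {τ : A} (hτ : τ ∈ Submodule.span K (Set.range e)) {j b : ℕ}
    (l : ℕ) (h : j + 1 < b) : chain p 1 j * τ * chain p b l ∈ chainSpan K e x p := by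
  refine mul_mul_mem_of_mem_span (L := (chainSpan K e x p).restrictScalars K) hτ _ _ ?_
  rintro _ ⟨ν, rfl⟩
  obtain ⟨ν', h'⟩ := H.chain_e 1 j ν
  rw [h', mul_assoc, (H.commute_chain_chain (by omega)).eq]
  exact mul_mem_chainSpan (e_mem_tail _)
    (mul_mem_chainSpan (chain_mem_tail _ (by omega)) (chain_mem_chainSpan _))

theorem chain_mul_x_mul_chain_mem (j l : ℕ) :
    chain p 1 j * x (j + 1) * chain p (j + 1) l ∈ chainSpan K e x p := by
  induction j generalizing l with
  | zero => simpa [chain] using mul_mem_chainSpan (x_mem_tail 1) (chain_mem_chainSpan l)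
  | succ j ih =>
    obtain ⟨τ, hτ, h, -⟩ := H.swap (j + 1)
    rw [chain, add_comm 1 j, mul_assoc (chain p 1 j), h, mul_add, add_mul]
    refine add_mem ?_ (H.chain_span_e_chain_mem hτ l (by omega))
    have := ih (l + 1)
    rw [chain_succ_left] at this
    simpa only [mul_assoc] using this

theorem mul_x_mem_chainSpan {u : A} (hu : u ∈ chainSpan K e x p) (s : ℕ) :
    u * x s ∈ chainSpan K e x p := by
  refine mul_right_mem_chainSpan (fun j => ?_) hu
  by_cases h₁ : s < 1 ∨ 1 + j < s
  · rw [← (H.commute_x_chain h₁).eq]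
    exact mul_mem_chainSpan (x_mem_tail s) (chain_mem_chainSpan j)
  rcases eq_or_ne s (j + 1) with rfl | h₂
  · simpa [chain] using H.chain_mul_x_mul_chain_mem j 0
  · obtain ⟨t, rfl⟩ : ∃ t, s = t + 1 := ⟨s - 1, by omega⟩
    obtain ⟨l, rfl⟩ : ∃ l, j = t + 1 + l := ⟨j - (t + 1), by omega⟩
    obtain ⟨τ, hτ, -, h⟩ := H.swap (t + 1)
    have key : chain p 1 (t + 1 + l) * x (t + 1) =
        x (t + 2) * chain p 1 (t + 1 + l) - chain p 1 t * τ * chain p (t + 2) l := by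
      rw [chain_add, mul_assoc, show 1 + (t + 1) = t + 2 by omega,
        ← (H.commute_x_chain (s := t + 1) (a := t + 2) (by omega)).eq, chain, add_comm 1 t,
        ← mul_assoc, mul_assoc (chain p 1 t), h, mul_sub, sub_mul, ← mul_assoc (chain p 1 t),
        ← (H.commute_x_chain (s := t + 2) (a := 1) (by omega)).eq]
      simp only [mul_assoc]
    rw [key]
    exact sub_mem (mul_mem_chainSpan (x_mem_tail _) (chain_mem_chainSpan _))
      (H.chain_span_e_chain_mem hτ l (by omega))

theorem mul_x_pow_mem_chainSpan {u : A} (hu : u ∈ chainSpan K e x p) (s a : ℕ) :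
    u * x s ^ a ∈ chainSpan K e x p := by
  induction a with
  | zero => simpa using hu
  | succ a ih => rw [pow_succ, ← mul_assoc]; exact H.mul_x_mem_chainSpan ih s

theorem mul_e_mem_chainSpan {u : A} (hu : u ∈ chainSpan K e x p) (ν : ι) :
    u * e ν ∈ chainSpan K e x p := by
  refine mul_right_mem_chainSpan (fun j => ?_) hu
  obtain ⟨ν', h⟩ := H.chain_e 1 j ν
  rw [h]
  exact mul_mem_chainSpan (e_mem_tail _) (chain_mem_chainSpan j)

theorem mul_p_mem_chainSpan {u : A} (hu : u ∈ chainSpan K e x p) (r : ℕ) :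
    u * p r ∈ chainSpan K e x p := by
  refine mul_right_mem_chainSpan (fun j => ?_) hu
  obtain _ | t := r
  · simp [H.p_zero]
  rcases lt_trichotomy t j with h | rfl | h
  · obtain ⟨l, rfl⟩ : ∃ l, j = t + 1 + l := ⟨j - (t + 1), by omega⟩
    obtain _ | l := l
    · have := mul_mul_mem_of_mem_span (L := (chainSpan K e x p).restrictScalars K)
        (H.sq (t + 1)) (chain p 1 t) 1 ?_
      · simpa [chain, add_comm 1 t, mul_assoc] using this
      rintro _ ⟨a, b, ν, rfl⟩
      rw [mul_one, ← mul_assoc, ← mul_assoc]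
      exact H.mul_e_mem_chainSpan
        (H.mul_x_pow_mem_chainSpan (H.mul_x_pow_mem_chainSpan (chain_mem_chainSpan t) _ _) _ _) ν
    have key : chain p 1 (t + 1 + (l + 1)) * p (t + 1) =
        p (t + 2) * chain p 1 (t + 1 + (l + 1)) +
        chain p 1 t * (p (t + 1) * p (t + 1 + 1) * p (t + 1) -
          p (t + 1 + 1) * p (t + 1) * p (t + 1 + 1)) * chain p (t + 3) l := by
      have hc : chain p 1 (t + 1 + (l + 1)) =
          chain p 1 t * p (t + 1) * p (t + 2) * chain p (t + 3) l := by
        rw [chain_add, chain, chain_succ_left]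
        simp only [mul_assoc, add_comm, add_left_comm]
        norm_num
      rw [hc, mul_assoc, ← (H.commute_p_chain (s := t + 1) (a := t + 3) (by omega)).eq]
      have h2 := (H.commute_p_chain (s := t + 2) (a := 1) (l := t) (by omega)).eq
      simp only [mul_sub, sub_mul, ← mul_assoc, h2]
      simp only [add_assoc, Nat.reduceAdd]
      abel
    rw [key]
    refine add_mem (mul_mem_chainSpan (p_mem_tail (by omega)) (chain_mem_chainSpan _)) ?_
    refine mul_mul_mem_of_mem_span (L := (chainSpan K e x p).restrictScalars K)
      (H.braid (t + 1)) _ _ ?_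
    rintro _ ⟨a, b, c, ν, rfl⟩
    obtain ⟨ν', hν⟩ := H.chain_e 1 t ν
    have hx : ∀ q c, q ≤ t + 2 → Commute (x q ^ c) (chain p (t + 3) l) := fun q c hq =>
      (H.commute_x_chain (by omega)).pow_left c
    have hx₃ : ∀ c, Commute (x (t + 1 + 2) ^ c) (chain p 1 t) := fun c =>
      (H.commute_x_chain (by omega)).pow_left c
    have hxe : ∀ q c, Commute (x q ^ c) (e ν) := fun q c => (H.x_e q ν).pow_left c
    have hxx : ∀ q q' c c', Commute (x q ^ c) (x q' ^ c') := fun q q' c c' =>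
      (H.x_x q q').pow_pow c c'
    have : chain p 1 t * (x (t + 1) ^ a * x (t + 1 + 1) ^ b * x (t + 1 + 2) ^ c * e ν) *
        chain p (t + 3) l = x (t + 1 + 2) ^ c * e ν' * chain p (t + 3) l *
          (chain p 1 t * x (t + 1) ^ a * x (t + 1 + 1) ^ b) := by
      calc _ = chain p 1 t * (x (t + 1 + 2) ^ c * ((x (t + 1) ^ a * x (t + 1 + 1) ^ b) * e ν)) *
            chain p (t + 3) l := by
              rw [((hxx _ _ a c).mul_left (hxx _ _ b c)).eq]
              simp only [mul_assoc]
        _ = x (t + 1 + 2) ^ c * (chain p 1 t * e ν) *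
            ((x (t + 1) ^ a * x (t + 1 + 1) ^ b) * chain p (t + 3) l) := by
              rw [((hxe _ a).mul_left (hxe _ b)).eq, ← mul_assoc, ← (hx₃ c).eq]
              simp only [mul_assoc]
        _ = x (t + 1 + 2) ^ c * e ν' * (chain p 1 t * chain p (t + 3) l) *
            (x (t + 1) ^ a * x (t + 1 + 1) ^ b) := by
              rw [hν, ((hx _ a (by omega)).mul_left (hx _ b (by omega))).eq]
              simp only [mul_assoc]
        _ = _ := by
              rw [(H.commute_chain_chain (by omega)).eq]
              simp only [mul_assoc]
    rw [this]
    exact mul_mem_chainSpan (mul_mem (mul_mem (pow_mem (x_mem_tail _) _) (e_mem_tail _))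
      (chain_mem_tail _ (by omega)))
      (H.mul_x_pow_mem_chainSpan (H.mul_x_pow_mem_chainSpan (chain_mem_chainSpan t) _ _) _ _)
  · have : chain p 1 t * p (t + 1) = chain p 1 (t + 1) := by rw [chain, add_comm 1 t]
    rw [this]
    exact chain_mem_chainSpan _
  · rw [← (H.commute_p_chain (by omega)).eq]
    exact mul_mem_chainSpan (p_mem_tail (by omega)) (chain_mem_chainSpan _)

theorem mem_chainSpan_of_mem_adjoin {u : A}
    (hu : u ∈ Algebra.adjoin K (Set.range e ∪ Set.range x ∪ Set.range p)) :
    u ∈ chainSpan K e x p := by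
  have key : ∀ v ∈ chainSpan K e x p, v * u ∈ chainSpan K e x p := by
    induction hu using Algebra.adjoin_induction with
    | mem g hg =>
      rcases hg with (⟨ν, rfl⟩ | ⟨r, rfl⟩) | ⟨r, rfl⟩
      · exact fun v hv => H.mul_e_mem_chainSpan hv ν
      · exact fun v hv => H.mul_x_mem_chainSpan hv r
      · exact fun v hv => H.mul_p_mem_chainSpan hv r
    | algebraMap c =>
      intro v hv
      rw [← Algebra.commutes]
      exact mul_mem_chainSpan (Subalgebra.algebraMap_mem _ c) hv
    | add g g' _ _ h h' => intro v hv; rw [mul_add]; exact add_mem (h v hv) (h' v hv)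
    | mul g g' _ _ h h' => intro v hv; rw [← mul_assoc]; exact h' _ (h v hv)
  simpa using key 1 (chain_mem_chainSpan 0)

theorem x_pow_mul_p_sub_mem (r c : ℕ) :
    x r ^ c * p r - p r * x (r + 1) ^ c ∈
      Submodule.span K {z | ∃ a b ν, z = x r ^ a * x (r + 1) ^ b * e ν} := by
  induction c with
  | zero => simp
  | succ c ih =>
    obtain ⟨τ, hτ, h, -⟩ := H.swap r
    have : x r ^ (c + 1) * p r - p r * x (r + 1) ^ (c + 1) =
        1 * (x r ^ c * p r - p r * x (r + 1) ^ c) * x (r + 1) - x r ^ c * τ * 1 := by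
      rw [pow_succ, mul_assoc, eq_sub_of_add_eq h.symm, pow_succ]
      noncomm_ring
    rw [this]
    refine sub_mem (mul_mul_mem_of_mem_span ih _ _ ?_) (mul_mul_mem_of_mem_span hτ _ _ ?_)
    · rintro _ ⟨a, b, ν, rfl⟩
      refine Submodule.subset_span ⟨a, b + 1, ν, ?_⟩
      rw [one_mul, mul_assoc, ← (H.x_e _ _).eq, pow_succ]
      simp only [mul_assoc]
    · rintro _ ⟨ν, rfl⟩
      exact Submodule.subset_span ⟨c, 0, ν, by simp⟩

/-- A left ideal `J` stable under right multiplication by all generators except `p_m` that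
contains `x_1^c f_1` and `x_{m+1}^{c'} f_{m+1}` also contains `x_1^{c+c'} f_1 p_1 ⋯ p_m`. -/
theorem pow_mul_chain_mem {m c c' : ℕ} {f : ℕ → A} {J : Submodule K A}
    (fx : ∀ s r, Commute (f s) (x r)) (fe : ∀ s ν, Commute (f s) (e ν))
    (fp : ∀ r, 2 ≤ r → Commute (f 1) (p r)) (fps : ∀ r, f r * p r = p r * f (r + 1))
    (hleft : ∀ a, ∀ b ∈ J, a * b ∈ J) (hx : ∀ b ∈ J, ∀ r, b * x r ∈ J)
    (hp : ∀ b ∈ J, ∀ r, r ≠ m → b * p r ∈ J)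
    (hc : x 1 ^ c * f 1 ∈ J) (hc' : x (m + 1) ^ c' * f (m + 1) ∈ J) (s l : ℕ) (hs : s + l = m) :
    x 1 ^ c * f 1 * (chain p 1 s * x (s + 1) ^ c' * chain p (s + 1) l) ∈ J := by
  induction l generalizing s with
  | zero =>
    obtain rfl : s = m := hs
    have hf : ∀ j, f 1 * chain p 1 j = chain p 1 j * f (j + 1) := fun j => by
      induction j with
      | zero => simp [chain]
      | succ j ih => rw [chain, ← mul_assoc, ih, mul_assoc, add_comm 1 j, fps, mul_assoc]
    have : x 1 ^ c * f 1 * (chain p 1 s * x (s + 1) ^ c' * chain p (s + 1) 0) =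
        x 1 ^ c * chain p 1 s * (x (s + 1) ^ c' * f (s + 1)) := by
      rw [chain, mul_one, mul_assoc, ← mul_assoc (f 1), hf, mul_assoc (chain p 1 s),
        ((fx (s + 1) (s + 1)).pow_right c').eq, mul_assoc]
    rw [this]
    exact hleft _ _ hc'
  | succ l ih =>
    have key : x 1 ^ c * f 1 * (chain p 1 s * x (s + 1) ^ c' * chain p (s + 1) (l + 1)) =
        x 1 ^ c * f 1 * (chain p 1 (s + 1) * x (s + 1 + 1) ^ c' * chain p (s + 1 + 1) l) +
        (x 1 ^ c * f 1 * chain p 1 s) *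
          (x (s + 1) ^ c' * p (s + 1) - p (s + 1) * x (s + 1 + 1) ^ c') *
            chain p (s + 1 + 1) l := by
      rw [chain_succ_left, chain, add_comm 1 s]
      noncomm_ring
    rw [key]
    refine add_mem (ih (s + 1) (by omega))
      (mul_mul_mem_of_mem_span (H.x_pow_mul_p_sub_mem (s + 1) c') _ _ ?_)
    rintro _ ⟨a, b, ν, rfl⟩
    obtain ⟨ν', hν⟩ := H.chain_e 1 s ν
    have hxJ : ∀ u ∈ J, u * x (s + 1) ^ a ∈ J := fun u hu => by
      induction a with
      | zero => simpa using hu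
      | succ a ih => rw [pow_succ, ← mul_assoc]; exact hx _ ih _
    have hcJ : ∀ j < m, x 1 ^ c * f 1 * chain p 1 j ∈ J := fun j => by
      induction j with
      | zero => intro _; simpa [chain] using hc
      | succ j ih => intro hj; rw [chain, ← mul_assoc]; exact hp _ (ih (by omega)) _ (by omega)
    have hy : ∀ u, Commute (x 1) u → Commute (f 1) u → Commute (x 1 ^ c * f 1) u :=
      fun u h h' => (h.pow_left c).mul_left h'
    have h₁ : Commute (x 1 ^ c * f 1 * chain p 1 s) (x (s + 1 + 1) ^ b) :=
      (hy _ ((H.x_x _ _).pow_right b) ((fx _ _).pow_right b)).mul_left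
        ((H.commute_x_chain (by omega)).symm.pow_right b)
    have h₂ : Commute (x 1 ^ c * f 1 * chain p 1 s) (chain p (s + 1 + 1) l) :=
      (hy _ (H.commute_x_chain (by omega)) (commute_chain fun r _ _ => fp r (by omega))).mul_left
        (H.commute_chain_chain (by omega))
    have h₃ : x 1 ^ c * f 1 * chain p 1 s * e ν = e ν' * (x 1 ^ c * f 1 * chain p 1 s) := by
      rw [mul_assoc, hν, ← mul_assoc, (hy _ (H.x_e 1 ν') (fe 1 ν')).eq, mul_assoc]
    have : x 1 ^ c * f 1 * chain p 1 s * (x (s + 1) ^ a * x (s + 1 + 1) ^ b * e ν) *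
        chain p (s + 1 + 1) l = x (s + 1 + 1) ^ b * e ν' * chain p (s + 1 + 1) l *
          (x 1 ^ c * f 1 * chain p 1 s * x (s + 1) ^ a) := by
      generalize hY : x 1 ^ c * f 1 * chain p 1 s = Y at *
      calc _ = Y * x (s + 1 + 1) ^ b * (x (s + 1) ^ a * e ν) * chain p (s + 1 + 1) l := by
              rw [((H.x_x (s + 1) (s + 1 + 1)).pow_pow a b).eq]
              simp only [mul_assoc]
        _ = x (s + 1 + 1) ^ b * (Y * e ν) * (x (s + 1) ^ a * chain p (s + 1 + 1) l) := by
              rw [h₁.eq, ((H.x_e (s + 1) ν).pow_left a).eq]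
              simp only [mul_assoc]
        _ = x (s + 1 + 1) ^ b * e ν' * (Y * chain p (s + 1 + 1) l) * x (s + 1) ^ a := by
              rw [h₃, ((H.commute_x_chain (s := s + 1) (a := s + 1 + 1) (l := l)
                (by omega)).pow_left a).eq]
              simp only [mul_assoc]
        _ = _ := by rw [h₂.eq]; simp only [mul_assoc]
    rw [this]
    exact hleft _ _ (hxJ _ (hcJ s (by omega)))

theorem pow_add_mul_mem {m c c' : ℕ} {f : ℕ → A} {J : Submodule K A}
    (fx : ∀ s r, Commute (f s) (x r)) (fe : ∀ s ν, Commute (f s) (e ν))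
    (fp : ∀ r, 2 ≤ r → Commute (f 1) (p r)) (fps : ∀ r, f r * p r = p r * f (r + 1))
    (hleft : ∀ a, ∀ b ∈ J, a * b ∈ J) (hx : ∀ b ∈ J, ∀ r, b * x r ∈ J)
    (hp : ∀ b ∈ J, ∀ r, r ≠ m → b * p r ∈ J)
    (hc : x 1 ^ c * f 1 ∈ J) (hc' : x (m + 1) ^ c' * f (m + 1) ∈ J) {u : A}
    (hu : u ∈ Algebra.adjoin K (Set.range e ∪ Set.range x ∪ Set.range p)) :
    x 1 ^ (c + c') * f 1 * u ∈ J := by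
  have hpJ : ∀ b ∈ J, ∀ q l, m < q ∨ q + l ≤ m → b * chain p q l ∈ J := fun b hb q l h => by
    induction l with
    | zero => simpa [chain] using hb
    | succ l ih =>
      rw [chain, ← mul_assoc]
      exact hp _ (ih (by omega)) _ (by omega)
  have hchain : ∀ j, x 1 ^ (c + c') * f 1 * chain p 1 j ∈ J := fun j => by
    by_cases h : j < m
    · refine hpJ _ ?_ _ _ (by omega)
      rw [add_comm, pow_add, mul_assoc]
      exact hleft _ _ hc
    · obtain ⟨l, rfl⟩ : ∃ l, j = m + l := ⟨j - m, by omega⟩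
      rw [chain_add, ← mul_assoc]
      refine hpJ _ ?_ _ _ (by omega)
      have := H.pow_mul_chain_mem fx fe fp fps hleft hx hp hc hc' 0 m (by omega)
      simp only [chain, one_mul, zero_add] at this
      rwa [pow_add, mul_assoc (x 1 ^ c), ← ((fx 1 1).pow_right c').eq, ← mul_assoc, mul_assoc]
  have hcomm : ∀ a ∈ tailSubalgebra K e x p, Commute (x 1 ^ (c + c') * f 1) a := fun a ha => by
    unfold tailSubalgebra at ha
    induction ha using Algebra.adjoin_induction with
    | mem g hg =>
      rcases hg with (⟨ν, rfl⟩ | ⟨r, rfl⟩) | ⟨r, hr, rfl⟩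
      · exact ((H.x_e 1 ν).pow_left _).mul_left (fe 1 ν)
      · exact ((H.x_x 1 r).pow_left _).mul_left (fx 1 r)
      · obtain _ | r := r
        · rw [H.p_zero]; exact Commute.zero_right _
        · have hr : r + 1 ≠ 1 := hr
          exact ((H.p_x (r + 1) 1 (by omega) (by omega)).symm.pow_left _).mul_left
            (fp _ (by omega))
    | algebraMap c => exact (Algebra.commutes c _).symm
    | add g g' _ _ h h' => exact h.add_right h'
    | mul g g' _ _ h h' => exact h.mul_right h'
  replace hu := H.mem_chainSpan_of_mem_adjoin hu
  unfold chainSpan at hu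
  induction hu using Submodule.span_induction with
  | mem u hu => obtain ⟨j, rfl⟩ := hu; exact hchain j
  | zero => simp
  | add u v _ _ hu hv => rw [mul_add]; exact J.add_mem hu hv
  | smul a u _ hu =>
    rw [Subalgebra.smul_def, smul_eq_mul, ← mul_assoc, (hcomm a a.2).eq, mul_assoc]
    exact hleft _ _ hu

end IsHeckeSystem

end Span

end S15

namespace S15

variable {k : Type} [Field k] {I : Type} [DecidableEq I]
  {a : I → I → ℤ} {d : I → ℤ} {t : I → I → ℕ → ℕ → k} {useCyc : Prop} {Λ : I → ℕ} {n : ℕ}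
  {ν₀ : Fin n → I}

local notation "π" => mkA k I a d t useCyc Λ n ν₀

theorem mkA_eq {u v : FA k I n} (h : Rel k I a d t useCyc Λ n ν₀ u v) : π u = π v :=
  RingQuot.mkAlgHom_rel k h

theorem mem_adjoin_generators (u : QHA k I a d t useCyc Λ n ν₀) :
    u ∈ Algebra.adjoin k (Set.range (fun ν : Fin n → I => π (E k I ν)) ∪
      Set.range (fun r => π (X k I r)) ∪ Set.range (fun r => π (P k I r))) := by
  obtain ⟨v, rfl⟩ := RingQuot.mkAlgHom_surjective k (Rel k I a d t useCyc Λ n ν₀) u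
  change π v ∈ _
  induction v using FreeAlgebra.induction with
  | grade0 c => rw [AlgHom.commutes]; exact Subalgebra.algebraMap_mem _ c
  | grade1 g =>
    refine Algebra.subset_adjoin ?_
    cases g with
    | e ν => exact Or.inl (Or.inl ⟨ν, rfl⟩)
    | x r => exact Or.inl (Or.inr ⟨r, rfl⟩)
    | p r => exact Or.inr ⟨r, rfl⟩
  | mul u v hu hv => rw [map_mul]; exact mul_mem hu hv
  | add u v hu hv => rw [map_add]; exact add_mem hu hv

theorem mkA_idem (ν ν' : Fin n → I) :
    π (E k I ν) * π (E k I ν') = if ν = ν' then π (E k I ν) else 0 := by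
  rw [← map_mul, mkA_eq (.idem ν ν')]
  split <;> simp

theorem mkA_commute_x_e (r : ℕ) (ν : Fin n → I) : Commute (π (X k I r)) (π (E k I ν)) := by
  rw [Commute, SemiconjBy, ← map_mul, ← map_mul]
  exact mkA_eq (.xe r ν)

theorem mkA_p_eq_zero {r : ℕ} (h : ¬(1 ≤ r ∧ r + 1 ≤ n)) : π (P k I r) = 0 := by
  rw [mkA_eq (.pzero r (by omega)), map_zero]

theorem mkA_p_mul_e {r : ℕ} (h1 : 1 ≤ r) (h2 : r + 1 ≤ n) (ν : Fin n → I) :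
    π (P k I r) * π (E k I ν) = π (E k I (swapAt I ν r h1 h2)) * π (P k I r) := by
  rw [← map_mul, ← map_mul, mkA_eq (.pe r h1 h2 ν)]

variable [Fintype I]

theorem sum_mkA_e : ∑ ν, π (E k I ν) = 1 := by
  rw [← map_one π, ← mkA_eq (.total), map_sum]
  exact (Finset.sum_subset (Finset.subset_univ _) fun ν _ h => by
    rw [mkA_eq (.support ν h), map_zero]).symm

/-- Sum over `ν` of an identity in which every factor `e(ν)` stands on the right. -/
theorem mem_of_forall_mul_e {L : Submodule k (QHA k I a d t useCyc Λ n ν₀)}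
    {u : QHA k I a d t useCyc Λ n ν₀} (h : ∀ ν, u * π (E k I ν) ∈ L) : u ∈ L := by
  rw [← mul_one u, ← sum_mkA_e, Finset.mul_sum]
  exact L.sum_mem fun ν _ => h ν

theorem mkA_swap (r : ℕ) : ∃ τ ∈ Submodule.span k (Set.range fun ν : Fin n → I => π (E k I ν)),
    π (P k I r) * π (X k I (r + 1)) = π (X k I r) * π (P k I r) + τ ∧
    π (P k I r) * π (X k I r) = π (X k I (r + 1)) * π (P k I r) - τ := by
  by_cases h : 1 ≤ r ∧ r + 1 ≤ n
  · obtain ⟨h1, h2⟩ := h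
    refine ⟨∑ ν : Fin n → I,
      if ν ⟨r - 1, by omega⟩ = ν ⟨r, by omega⟩ then π (E k I ν) else 0, ?_, ?_, ?_⟩
    · refine Submodule.sum_mem _ fun ν _ => ?_
      split
      · exact Submodule.subset_span ⟨ν, rfl⟩
      · exact Submodule.zero_mem _
    · rw [← mul_one (π (P k I r) * _), ← mul_one (π (X k I r) * _), ← sum_mkA_e, Finset.mul_sum,
        Finset.mul_sum, ← Finset.sum_add_distrib]
      refine Finset.sum_congr rfl fun ν _ => ?_
      have := mkA_eq (Rel.xp (k := k) (a := a) (d := d) (t := t) (useCyc := useCyc) (Λ := Λ)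
        (ν₀ := ν₀) r h1 h2 ν)
      simp only [map_mul, map_sub, apply_ite (π), map_zero] at this
      rw [this, sub_add_cancel]
    · rw [← mul_one (π (P k I r) * _), ← mul_one (π (X k I (r + 1)) * _), ← sum_mkA_e,
        Finset.mul_sum, Finset.mul_sum, ← Finset.sum_sub_distrib]
      refine Finset.sum_congr rfl fun ν _ => ?_
      have := mkA_eq (Rel.px' (k := k) (a := a) (d := d) (t := t) (useCyc := useCyc) (Λ := Λ)
        (ν₀ := ν₀) r h1 h2 ν)
      simp only [map_mul, map_add, apply_ite (π), map_zero] at this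
      rw [this, add_sub_cancel_right]
  · exact ⟨0, Submodule.zero_mem _, by simp [mkA_p_eq_zero h]⟩

theorem isHeckeSystem_mkA : IsHeckeSystem k (fun ν : Fin n → I => π (E k I ν))
    (fun r => π (X k I r)) (fun r => π (P k I r)) where
  p_zero := mkA_p_eq_zero (by omega)
  p_e r ν := by
    by_cases h : 1 ≤ r ∧ r + 1 ≤ n
    · exact ⟨_, mkA_p_mul_e h.1 h.2 ν⟩
    · exact ⟨ν, by simp [mkA_p_eq_zero h]⟩
  x_e := mkA_commute_x_e
  x_x r s := by
    rw [Commute, SemiconjBy, ← map_mul, ← map_mul]; exact mkA_eq (.xx r s)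
  p_x r s h h' := by
    rw [Commute, SemiconjBy, ← map_mul, ← map_mul]; exact mkA_eq (.px r s h h')
  p_p r s h := by
    rw [Commute, SemiconjBy, ← map_mul, ← map_mul]; exact mkA_eq (.pp r s h)
  swap := mkA_swap
  sq r := by
    by_cases h : 1 ≤ r ∧ r + 1 ≤ n
    · refine mem_of_forall_mul_e fun ν => ?_
      rw [← map_mul, ← map_mul, mkA_eq (.psq r h.1 h.2 ν), Qev]
      simp only [Finset.sum_mul, map_sum, smul_mul_assoc, map_smul, map_mul, map_pow]
      exact Submodule.sum_mem _ fun b _ => Submodule.sum_mem _ fun c _ =>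
        Submodule.smul_mem _ _ (Submodule.subset_span ⟨b, c, ν, rfl⟩)
    · simp [mkA_p_eq_zero h]
  braid r := by
    by_cases h : 1 ≤ r ∧ r + 2 ≤ n
    · rw [← neg_sub]
      refine Submodule.neg_mem _ (mem_of_forall_mul_e fun ν => ?_)
      have := mkA_eq (Rel.braid (k := k) (a := a) (d := d) (t := t) (useCyc := useCyc) (Λ := Λ)
        (ν₀ := ν₀) r h.1 h.2 ν)
      rw [map_mul, map_sub, map_mul, map_mul, map_mul, map_mul] at this
      rw [this]
      split
      · rw [DDev]
        simp only [Finset.sum_mul, Finset.smul_sum, map_sum, smul_mul_assoc, map_smul, map_mul,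
          map_pow]
        refine Submodule.sum_mem _ fun b _ => Submodule.sum_mem _ fun c _ =>
          Submodule.sum_mem _ fun b' _ =>
            Submodule.smul_mem _ _ (Submodule.subset_span ⟨b', c, b - 1 - b', ν, ?_⟩)
        have hx : Commute (π (X k I (r + 2))) (π (X k I (r + 1))) := by
          rw [Commute, SemiconjBy, ← map_mul, ← map_mul]; exact mkA_eq (.xx _ _)
        rw [mul_assoc (π (X k I r) ^ b'), (hx.pow_pow _ _).eq, ← mul_assoc (π (X k I r) ^ b')]
      · simp
    · by_cases h' : r = 0
      · have := mkA_p_eq_zero (k := k) (a := a) (d := d) (t := t) (useCyc := useCyc) (Λ := Λ)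
          (ν₀ := ν₀) (r := r) (by omega)
        simp [this]
      · have := mkA_p_eq_zero (k := k) (a := a) (d := d) (t := t) (useCyc := useCyc) (Λ := Λ)
          (ν₀ := ν₀) (r := r + 1) (by omega)
        simp [this]

variable (k a d t useCyc Λ ν₀) in
/-- The sum of the idempotents `e(ν)` over the sequences with entry `i` at position `s`. -/
def colorIdem (i : I) (s : ℕ) : QHA k I a d t useCyc Λ n ν₀ :=
  ∑ ν : Fin n → I, if ∃ l : Fin n, (l : ℕ) + 1 = s ∧ ν l = i then π (E k I ν) else 0

local notation "f" => colorIdem k a d t useCyc Λ ν₀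

theorem colorIdem_mul_e (i : I) (s : ℕ) (ν : Fin n → I) : f i s * π (E k I ν) =
    if ∃ l : Fin n, (l : ℕ) + 1 = s ∧ ν l = i then π (E k I ν) else 0 := by
  rw [colorIdem, Finset.sum_mul]
  simp only [ite_mul, mkA_idem, zero_mul]
  rw [Finset.sum_eq_single ν (fun μ _ h => by simp [h]) (by simp)]
  simp

theorem e_mul_colorIdem (i : I) (s : ℕ) (ν : Fin n → I) : π (E k I ν) * f i s =
    if ∃ l : Fin n, (l : ℕ) + 1 = s ∧ ν l = i then π (E k I ν) else 0 := by
  rw [colorIdem, Finset.mul_sum]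
  simp only [mul_ite, mkA_idem, mul_zero]
  rw [Finset.sum_eq_single ν (fun μ _ h => by simp [h.symm]) (by simp)]
  simp

theorem commute_colorIdem_e (i : I) (s : ℕ) (ν : Fin n → I) :
    Commute (f i s) (π (E k I ν)) :=
  (colorIdem_mul_e i s ν).trans (e_mul_colorIdem i s ν).symm

theorem commute_colorIdem_x (i : I) (s r : ℕ) : Commute (f i s) (π (X k I r)) := by
  refine Commute.sum_left _ _ _ fun ν _ => ?_
  split
  · exact (mkA_commute_x_e r ν).symm
  · exact Commute.zero_left _

theorem colorIdem_mul_p (i : I) {s s' r : ℕ}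
    (h : ∀ (h1 : 1 ≤ r) (h2 : r + 1 ≤ n) (ν : Fin n → I),
      (∃ l : Fin n, (l : ℕ) + 1 = s ∧ swapAt I ν r h1 h2 l = i) ↔
        ∃ l : Fin n, (l : ℕ) + 1 = s' ∧ ν l = i) :
    f i s * π (P k I r) = π (P k I r) * f i s' := by
  by_cases hr : 1 ≤ r ∧ r + 1 ≤ n
  · rw [← mul_one (f i s * _), ← sum_mkA_e, Finset.mul_sum,
      show f i s' = ∑ ν : Fin n → I, _ from rfl, Finset.mul_sum]
    refine Finset.sum_congr rfl fun ν _ => ?_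
    rw [mul_assoc, mkA_p_mul_e hr.1 hr.2, ← mul_assoc, colorIdem_mul_e]
    simp only [h hr.1 hr.2 ν]
    split
    · exact (mkA_p_mul_e hr.1 hr.2 ν).symm
    · simp
  · simp [mkA_p_eq_zero hr]

theorem commute_colorIdem_p (i : I) {r : ℕ} (hr : 2 ≤ r) : Commute (f i 1) (π (P k I r)) := by
  refine colorIdem_mul_p i fun h1 h2 ν => exists_congr fun l => and_congr_right fun hl => ?_
  rw [swapAt, if_neg (by omega), if_neg (by omega)]

theorem colorIdem_mul_p_self (i : I) (r : ℕ) :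
    f i r * π (P k I r) = π (P k I r) * f i (r + 1) := by
  refine colorIdem_mul_p i fun h1 h2 ν => ⟨?_, ?_⟩
  · rintro ⟨l, hl, h⟩
    rw [swapAt, if_pos hl] at h
    exact ⟨⟨r, by omega⟩, rfl, h⟩
  · rintro ⟨l, hl, h⟩
    refine ⟨⟨r - 1, by omega⟩, by simp; omega, ?_⟩
    rw [swapAt, if_pos (by simp; omega), ← h]
    congr 1; ext; simp; omega

/-- The annihilation statement for the quiver Hecke algebra: a left ideal `J` stable under right
multiplication by all generators except `ψ_m` that contains the cyclotomic elements at positions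
`1` and `m + 1` contains `x_1^{c+c'} e(ν) u` for all `u`. -/
theorem pow_mul_e_mul_mem {m : ℕ} {J : Submodule k (QHA k I a d t useCyc Λ n ν₀)}
    (hleft : ∀ a, ∀ b ∈ J, a * b ∈ J) (hx : ∀ b ∈ J, ∀ r, b * π (X k I r) ∈ J)
    (hp : ∀ b ∈ J, ∀ r, r ≠ m → b * π (P k I r) ∈ J) {c c' : I → ℕ} (hn : 0 < n) (hm : m < n)
    (hc : ∀ ν : Fin n → I, π (X k I 1) ^ c (ν ⟨0, hn⟩) * π (E k I ν) ∈ J)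
    (hc' : ∀ ν : Fin n → I, π (X k I (m + 1)) ^ c' (ν ⟨m, hm⟩) * π (E k I ν) ∈ J)
    (ν : Fin n → I) (u : QHA k I a d t useCyc Λ n ν₀) :
    π (X k I 1) ^ (c (ν ⟨0, hn⟩) + c' (ν ⟨0, hn⟩)) * π (E k I ν) * u ∈ J := by
  set i := ν ⟨0, hn⟩ with hi
  have color_mem : ∀ (s : ℕ) (hs : s < n) (g : I → ℕ),
      (∀ ν : Fin n → I, π (X k I (s + 1)) ^ g (ν ⟨s, hs⟩) * π (E k I ν) ∈ J) →
      π (X k I (s + 1)) ^ g i * f i (s + 1) ∈ J := fun s hs g h => by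
    rw [colorIdem, Finset.mul_sum]
    refine J.sum_mem fun μ _ => ?_
    split
    case isTrue hl =>
      obtain ⟨l, hl, h'⟩ := hl
      obtain rfl : l = ⟨s, hs⟩ := Fin.ext (by simpa using hl)
      rw [← h']; exact h μ
    case isFalse => simp
  have he : π (E k I ν) = π (E k I ν) * f i 1 := by
    rw [e_mul_colorIdem, if_pos ⟨⟨0, hn⟩, rfl, rfl⟩]
  rw [he, ← mul_assoc, ((mkA_commute_x_e 1 ν).pow_left _).eq, mul_assoc, mul_assoc]
  refine hleft _ _ ?_
  rw [← mul_assoc]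
  exact isHeckeSystem_mkA.pow_add_mul_mem (commute_colorIdem_x i) (commute_colorIdem_e i)
    (fun r => commute_colorIdem_p i) (colorIdem_mul_p_self i) hleft hx hp
    (color_mem 0 hn c hc) (color_mem m hm c' hc') (mem_adjoin_generators u)

/-- A balancing relation tested against decompositions of `1` holds without the idempotents. -/
theorem tmul_sub_tmul_mem_of_forall {K R A B M N κ κ' : Type*} [CommRing K] [Ring R] [Algebra K R]
    [Ring A] [Ring B] [AddCommGroup M] [Module A M] [Module K M] [AddCommGroup N] [Module B N]
    [Module K N] [Fintype κ] [Fintype κ'] {eR : κ → κ' → R} {eA : κ → A} {eB : κ' → B}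
    (hR : ∑ i, ∑ j, eR i j = 1) (hA : ∑ i, eA i = 1) (hB : ∑ j, eB j = 1)
    {U : Submodule K (TensorProduct K R (TensorProduct K M N))} {r G : R} {g : A} {g' : B}
    {x : M} {y : N}
    (h : ∀ i j, TensorProduct.tmul K (r * (G * eR i j)) (TensorProduct.tmul K x y) -
      TensorProduct.tmul K r (TensorProduct.tmul K ((g * eA i) • x) ((g' * eB j) • y)) ∈ U) :
    TensorProduct.tmul K (r * G) (TensorProduct.tmul K x y) -
      TensorProduct.tmul K r (TensorProduct.tmul K (g • x) (g' • y)) ∈ U := by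
  have h1 : r * G = ∑ i, ∑ j, r * (G * eR i j) := by
    simp only [← Finset.mul_sum, hR, mul_one]
  have h2 : g • x = ∑ i, (g * eA i) • x := by
    rw [← Finset.sum_smul, ← Finset.mul_sum, hA, mul_one]
  have h3 : g' • y = ∑ j, (g' * eB j) • y := by
    rw [← Finset.sum_smul, ← Finset.mul_sum, hB, mul_one]
  rw [h1, h2, h3]
  simp only [TensorProduct.sum_tmul, TensorProduct.tmul_sum]
  rw [Finset.sum_comm (s := Finset.univ (α := κ'))]
  simp only [← Finset.sum_sub_distrib]
  exact U.sum_mem fun i _ => U.sum_mem fun j _ => h i j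

theorem sum_mkA_e_append {m m' : ℕ} {ν₀ : Fin (m + m') → I} :
    ∑ μ : Fin m → I, ∑ μ' : Fin m' → I,
      mkA k I a d t useCyc Λ (m + m') ν₀ (E k I (Fin.append μ μ')) = 1 := by
  rw [← sum_mkA_e, ← (Fin.appendEquiv m m').sum_comp, Fintype.sum_prod_type]
  rfl

end S15

open S15 TensorProduct

/-- Let `Λ, Λ'` be dominant integral weights, `β, β' ∈ Q^+` (of
heights `m, m'`, encoded by `ν₁ ∈ I^β`, `ν₂ ∈ I^{β'}`), `M` a finite-dimensional
`R^Λ(β)`-module and `N` a finite-dimensional `R^{Λ'}(β')`-module.  Then for every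
`ν ∈ I^{β+β'}`, the element `x_1^{⟨α_{ν_1}^∨, Λ+Λ'⟩} e(ν)` annihilates the convolution
product `M∘N = R(β+β') e(β,β') ⊗_{R(β)⊗R(β')} (M⊗N)`; hence `M∘N` factors through the
cyclotomic quotient `R^{Λ+Λ'}(β+β')`.  (Here `M∘N` is realised as the quotient of
`R(β+β') ⊗_k (M ⊗_k N)` by the `k`-span `U` of the balancing relations over the
generators of the parabolic subalgebra `R(β) ⊗ R(β')`; the conclusion says that left
multiplication by `x_1^{⟨α_{ν_1}^∨, Λ+Λ'⟩} e(ν)` maps everything into `U`.) -/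
theorem stmt15 (k : Type) [Field k] (I : Type) [Fintype I] [DecidableEq I]
    (a : I → I → ℤ) (d : I → ℤ)
    (hdiag : ∀ i, a i i = 2)
    (hoff : ∀ i j, i ≠ j → a i j ≤ 0)
    (hzero : ∀ i j, a i j = 0 ↔ a j i = 0)
    (hd : ∀ i, 1 ≤ d i)
    (hsymm : ∀ i j, d i * a i j = d j * a j i)
    (t : I → I → ℕ → ℕ → k)
    (htdiag : ∀ i p q, t i i p q = 0)
    (htsym : ∀ i j p q, t i j p q = t j i q p)
    (htsupp : ∀ i j p q, t i j p q ≠ 0 →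
      (p : ℤ) * (2 * d i) + (q : ℤ) * (2 * d j) + 2 * (d i * a i j) = 0)
    (htnorm : ∀ i j, i ≠ j → IsUnit (t i j (-(a i j)).toNat 0))
    (Λ Λ' : I → ℕ) (m m' : ℕ) (hm : 1 ≤ m) (hm' : 1 ≤ m')
    (ν₁ : Fin m → I) (ν₂ : Fin m' → I)
    (M : Type) [AddCommGroup M] [Module (QHA k I a d t True Λ m ν₁) M]
      [Module k M] [IsScalarTower k (QHA k I a d t True Λ m ν₁) M]
      [Module.Finite k M]
    (N : Type) [AddCommGroup N] [Module (QHA k I a d t True Λ' m' ν₂) N]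
      [Module k N] [IsScalarTower k (QHA k I a d t True Λ' m' ν₂) N]
      [Module.Finite k N] :
    -- the big (non-cyclotomic) algebra `R(β+β')` and the balancing submodule `U`
    ∀ U : Submodule k
        ((QHA k I a d t False (fun _ => 0) (m + m') (Fin.append ν₁ ν₂)) ⊗[k] (M ⊗[k] N)),
      U = Submodule.span k
        {z | ∃ (rr : QHA k I a d t False (fun _ => 0) (m + m') (Fin.append ν₁ ν₂))
               (mm : M) (nn : N) (μ : Fin m → I) (μ' : Fin m' → I),
          (z = (rr * mkA k I a d t False (fun _ => 0) (m + m') (Fin.append ν₁ ν₂)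
                      (E k I (Fin.append μ μ'))) ⊗ₜ[k] (mm ⊗ₜ[k] nn) -
               rr ⊗ₜ[k] (((mkA k I a d t True Λ m ν₁ (E k I μ)) • mm) ⊗ₜ[k]
                         ((mkA k I a d t True Λ' m' ν₂ (E k I μ')) • nn))) ∨
          (∃ i, 1 ≤ i ∧ i ≤ m ∧
            z = (rr * mkA k I a d t False (fun _ => 0) (m + m') (Fin.append ν₁ ν₂)
                      (X k I i * E k I (Fin.append μ μ'))) ⊗ₜ[k] (mm ⊗ₜ[k] nn) -
                rr ⊗ₜ[k] (((mkA k I a d t True Λ m ν₁ (X k I i * E k I μ)) • mm) ⊗ₜ[k]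
                          ((mkA k I a d t True Λ' m' ν₂ (E k I μ')) • nn))) ∨
          (∃ j, 1 ≤ j ∧ j + 1 ≤ m ∧
            z = (rr * mkA k I a d t False (fun _ => 0) (m + m') (Fin.append ν₁ ν₂)
                      (P k I j * E k I (Fin.append μ μ'))) ⊗ₜ[k] (mm ⊗ₜ[k] nn) -
                rr ⊗ₜ[k] (((mkA k I a d t True Λ m ν₁ (P k I j * E k I μ)) • mm) ⊗ₜ[k]
                          ((mkA k I a d t True Λ' m' ν₂ (E k I μ')) • nn))) ∨
          (∃ i, 1 ≤ i ∧ i ≤ m' ∧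
            z = (rr * mkA k I a d t False (fun _ => 0) (m + m') (Fin.append ν₁ ν₂)
                      (X k I (m + i) * E k I (Fin.append μ μ'))) ⊗ₜ[k] (mm ⊗ₜ[k] nn) -
                rr ⊗ₜ[k] (((mkA k I a d t True Λ m ν₁ (E k I μ)) • mm) ⊗ₜ[k]
                          ((mkA k I a d t True Λ' m' ν₂ (X k I i * E k I μ')) • nn))) ∨
          (∃ j, 1 ≤ j ∧ j + 1 ≤ m' ∧
            z = (rr * mkA k I a d t False (fun _ => 0) (m + m') (Fin.append ν₁ ν₂)
                      (P k I (m + j) * E k I (Fin.append μ μ'))) ⊗ₜ[k] (mm ⊗ₜ[k] nn) -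
                rr ⊗ₜ[k] (((mkA k I a d t True Λ m ν₁ (E k I μ)) • mm) ⊗ₜ[k]
                          ((mkA k I a d t True Λ' m' ν₂ (P k I j * E k I μ')) • nn)))} →
      ∀ ν : Fin (m + m') → I,
        ∀ z : (QHA k I a d t False (fun _ => 0) (m + m') (Fin.append ν₁ ν₂)) ⊗[k] (M ⊗[k] N),
          TensorProduct.map
            (LinearMap.mulLeft k
              (mkA k I a d t False (fun _ => 0) (m + m') (Fin.append ν₁ ν₂)
                (X k I 1 ^ (Λ (ν ⟨0, by omega⟩) + Λ' (ν ⟨0, by omega⟩)) * E k I ν)))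
            LinearMap.id z ∈ U := by
  intro U hU ν z
  set ρ := mkA k I a d t False (fun _ => 0) (m + m') (Fin.append ν₁ ν₂)
  have eq_append : ∀ μ : Fin (m + m') → I, ∃ (μ₁ : Fin m → I) (μ₂ : Fin m' → I),
      μ = Fin.append μ₁ μ₂ := fun μ =>
    ⟨_, _, ((Fin.appendEquiv m m').apply_symm_apply μ).symm⟩
  have U_left : ∀ r, ∀ w ∈ U, TensorProduct.map (LinearMap.mulLeft k r) LinearMap.id w ∈ U := by
    intro r w hw
    rw [hU] at hw
    induction hw using Submodule.span_induction with
    | zero => simp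
    | add v w _ _ hv hw => rw [map_add]; exact U.add_mem hv hw
    | smul c w _ hw => rw [map_smul]; exact U.smul_mem c hw
    | mem w hw =>
      rw [hU]
      refine Submodule.subset_span ?_
      obtain ⟨rr, mm, nn, μ, μ', hw⟩ := hw
      refine ⟨r * rr, mm, nn, μ, μ', ?_⟩
      rcases hw with rfl | ⟨i, h1, h2, rfl⟩ | ⟨i, h1, h2, rfl⟩ | ⟨i, h1, h2, rfl⟩ |
        ⟨i, h1, h2, rfl⟩
      · exact Or.inl (by simp [mul_assoc])
      · exact Or.inr (Or.inl ⟨i, h1, h2, by simp [mul_assoc]⟩)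
      · exact Or.inr (Or.inr (Or.inl ⟨i, h1, h2, by simp [mul_assoc]⟩))
      · exact Or.inr (Or.inr (Or.inr (Or.inl ⟨i, h1, h2, by simp [mul_assoc]⟩)))
      · exact Or.inr (Or.inr (Or.inr (Or.inr ⟨i, h1, h2, by simp [mul_assoc]⟩)))
  have bal_e : ∀ rr (mm : M) (nn : N) μ μ',
      (rr * ρ (E k I (Fin.append μ μ'))) ⊗ₜ[k] (mm ⊗ₜ[k] nn) -
      rr ⊗ₜ[k] ((mkA k I a d t True Λ m ν₁ (E k I μ) • mm) ⊗ₜ[k]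
        (mkA k I a d t True Λ' m' ν₂ (E k I μ') • nn)) ∈ U := fun rr mm nn μ μ' => by
    rw [hU]
    exact Submodule.subset_span ⟨rr, mm, nn, μ, μ', Or.inl rfl⟩
  have bal_x : ∀ i, 1 ≤ i → i ≤ m → ∀ rr (mm : M) (nn : N),
      (rr * ρ (X k I i)) ⊗ₜ[k] (mm ⊗ₜ[k] nn) -
        rr ⊗ₜ[k] ((mkA k I a d t True Λ m ν₁ (X k I i) • mm) ⊗ₜ[k]
          ((1 : QHA k I a d t True Λ' m' ν₂) • nn)) ∈ U := fun i h1 h2 rr mm nn => by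
    refine tmul_sub_tmul_mem_of_forall sum_mkA_e_append sum_mkA_e sum_mkA_e fun μ μ' => ?_
    rw [one_mul, ← map_mul, ← map_mul, hU]
    exact Submodule.subset_span ⟨rr, mm, nn, μ, μ', Or.inr (Or.inl ⟨i, h1, h2, rfl⟩)⟩
  have bal_p : ∀ i, 1 ≤ i → i + 1 ≤ m → ∀ rr (mm : M) (nn : N),
      (rr * ρ (P k I i)) ⊗ₜ[k] (mm ⊗ₜ[k] nn) -
        rr ⊗ₜ[k] ((mkA k I a d t True Λ m ν₁ (P k I i) • mm) ⊗ₜ[k]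
          ((1 : QHA k I a d t True Λ' m' ν₂) • nn)) ∈ U := fun i h1 h2 rr mm nn => by
    refine tmul_sub_tmul_mem_of_forall sum_mkA_e_append sum_mkA_e sum_mkA_e fun μ μ' => ?_
    rw [one_mul, ← map_mul, ← map_mul, hU]
    exact Submodule.subset_span ⟨rr, mm, nn, μ, μ', Or.inr (Or.inr (Or.inl ⟨i, h1, h2, rfl⟩))⟩
  have bal_x' : ∀ i, 1 ≤ i → i ≤ m' → ∀ rr (mm : M) (nn : N),
      (rr * ρ (X k I (m + i))) ⊗ₜ[k] (mm ⊗ₜ[k] nn) -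
        rr ⊗ₜ[k] (((1 : QHA k I a d t True Λ m ν₁) • mm) ⊗ₜ[k]
          (mkA k I a d t True Λ' m' ν₂ (X k I i) • nn)) ∈ U := fun i h1 h2 rr mm nn => by
    refine tmul_sub_tmul_mem_of_forall sum_mkA_e_append sum_mkA_e sum_mkA_e fun μ μ' => ?_
    rw [one_mul, ← map_mul, ← map_mul, hU]
    exact Submodule.subset_span
      ⟨rr, mm, nn, μ, μ', Or.inr (Or.inr (Or.inr (Or.inl ⟨i, h1, h2, rfl⟩)))⟩
  have bal_p' : ∀ i, 1 ≤ i → i + 1 ≤ m' → ∀ rr (mm : M) (nn : N),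
      (rr * ρ (P k I (m + i))) ⊗ₜ[k] (mm ⊗ₜ[k] nn) -
        rr ⊗ₜ[k] (((1 : QHA k I a d t True Λ m ν₁) • mm) ⊗ₜ[k]
          (mkA k I a d t True Λ' m' ν₂ (P k I i) • nn)) ∈ U := fun i h1 h2 rr mm nn => by
    refine tmul_sub_tmul_mem_of_forall sum_mkA_e_append sum_mkA_e sum_mkA_e fun μ μ' => ?_
    rw [one_mul, ← map_mul, ← map_mul, hU]
    exact Submodule.subset_span
      ⟨rr, mm, nn, μ, μ', Or.inr (Or.inr (Or.inr (Or.inr ⟨i, h1, h2, rfl⟩)))⟩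
  have mem_of_bal : ∀ {u v}, u - v ∈ U → v ∈ U → u ∈ U := fun h hv => by
    simpa using U.add_mem h hv
  let J : Submodule k (QHA k I a d t False (fun _ => 0) (m + m') (Fin.append ν₁ ν₂)) :=
    ⨅ v : M × N, U.comap ((TensorProduct.mk k _ (M ⊗[k] N)).flip (v.1 ⊗ₜ[k] v.2))
  have hJ : ∀ b, b ∈ J ↔ ∀ (mm : M) (nn : N), b ⊗ₜ[k] (mm ⊗ₜ[k] nn) ∈ U := fun b => by
    simp [J]
  have hleft : ∀ r, ∀ b ∈ J, r * b ∈ J := fun r b hb => (hJ _).2 fun mm nn => by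
    simpa using U_left r _ ((hJ b).1 hb mm nn)
  have hx : ∀ b ∈ J, ∀ r, b * ρ (X k I r) ∈ J := fun b hb r => by
    rw [hJ] at hb ⊢
    intro mm nn
    by_cases h : r = 0 ∨ m + m' < r
    · rw [mkA_eq (.xzero r h)]; simp
    by_cases h' : r ≤ m
    · exact mem_of_bal (bal_x r (by omega) h' b mm nn) (hb _ _)
    · obtain ⟨i, rfl⟩ : ∃ i, r = m + i := ⟨r - m, by omega⟩
      exact mem_of_bal (bal_x' i (by omega) (by omega) b mm nn) (hb _ _)
  have hp : ∀ b ∈ J, ∀ r, r ≠ m → b * ρ (P k I r) ∈ J := fun b hb r hr => by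
    rw [hJ] at hb ⊢
    intro mm nn
    by_cases h : r = 0 ∨ m + m' ≤ r
    · rw [mkA_eq (.pzero r h)]; simp
    by_cases h' : r < m
    · exact mem_of_bal (bal_p r (by omega) h' b mm nn) (hb _ _)
    · obtain ⟨i, rfl⟩ : ∃ i, r = m + i := ⟨r - m, by omega⟩
      exact mem_of_bal (bal_p' i (by omega) (by omega) b mm nn) (hb _ _)
  have bal_pow : ∀ (c : ℕ) (mm : M) (nn : N), (ρ (X k I 1) ^ c) ⊗ₜ[k] (mm ⊗ₜ[k] nn) -
      1 ⊗ₜ[k] ((mkA k I a d t True Λ m ν₁ (X k I 1 ^ c) • mm) ⊗ₜ[k] nn) ∈ U := fun c => by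
    induction c with
    | zero => simp
    | succ c ih =>
      intro mm nn
      have h1 := bal_x 1 le_rfl hm (ρ (X k I 1) ^ c) mm nn
      have h2 := ih (mkA k I a d t True Λ m ν₁ (X k I 1) • mm) nn
      rw [one_smul] at h1
      rw [smul_smul, ← map_mul, ← pow_succ] at h2
      rw [pow_succ]
      simpa using U.add_mem h1 h2
  have bal_pow' : ∀ (c : ℕ) (mm : M) (nn : N), (ρ (X k I (m + 1)) ^ c) ⊗ₜ[k] (mm ⊗ₜ[k] nn) -
      1 ⊗ₜ[k] (mm ⊗ₜ[k] (mkA k I a d t True Λ' m' ν₂ (X k I 1 ^ c) • nn)) ∈ U := fun c => by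
    induction c with
    | zero => simp
    | succ c ih =>
      intro mm nn
      have h1 := bal_x' 1 le_rfl hm' (ρ (X k I (m + 1)) ^ c) mm nn
      have h2 := ih mm (mkA k I a d t True Λ' m' ν₂ (X k I 1) • nn)
      rw [one_smul] at h1
      rw [smul_smul, ← map_mul, ← pow_succ] at h2
      rw [pow_succ]
      simpa using U.add_mem h1 h2
  have hc : ∀ μ : Fin (m + m') → I,
      ρ (X k I 1) ^ Λ (μ ⟨0, by omega⟩) * ρ (E k I μ) ∈ J := fun μ => by
    obtain ⟨μ₁, μ₂, rfl⟩ := eq_append μ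
    rw [hJ]
    intro mm nn
    have h0 : Fin.append μ₁ μ₂ ⟨0, by omega⟩ = μ₁ ⟨0, hm⟩ := Fin.append_left μ₁ μ₂ ⟨0, hm⟩
    refine mem_of_bal (bal_e _ mm nn μ₁ μ₂) (mem_of_bal (bal_pow _ _ _) ?_)
    rw [h0, smul_smul, ← map_mul, mkA_eq (.cyc trivial hm μ₁)]
    simp
  have hc' : ∀ μ : Fin (m + m') → I,
      ρ (X k I (m + 1)) ^ Λ' (μ ⟨m, by omega⟩) * ρ (E k I μ) ∈ J := fun μ => by
    obtain ⟨μ₁, μ₂, rfl⟩ := eq_append μ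
    rw [hJ]
    intro mm nn
    have h0 : Fin.append μ₁ μ₂ ⟨m, by omega⟩ = μ₂ ⟨0, hm'⟩ := Fin.append_right μ₁ μ₂ ⟨0, hm'⟩
    refine mem_of_bal (bal_e _ mm nn μ₁ μ₂) (mem_of_bal (bal_pow' _ _ _) ?_)
    rw [h0, smul_smul, ← map_mul, mkA_eq (.cyc trivial hm' μ₂)]
    simp
  have main := pow_mul_e_mul_mem hleft hx hp (by omega) (by omega) hc hc' ν
  induction z using TensorProduct.induction_on with
  | zero => simp
  | add v w hv hw => rw [map_add]; exact U.add_mem hv hw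
  | tmul r v =>
    induction v using TensorProduct.induction_on with
    | zero => simp
    | add v w hv hw => rw [TensorProduct.tmul_add, map_add]; exact U.add_mem hv hw
    | tmul mm nn =>
      have := (hJ _).1 (main r) mm nn
      rwa [← map_pow, ← map_mul] at this
end

section
/- Let ν ∈ I^n and let a, b ∈ ℤ_{>0} with a < n and a + b ≤ n. In the type C_∞ quiver Hecke algebra, the following hold. (1) If |ν_i − ν_{a+1}| ≥ 2 for 1 ≤ i ≤ a, then Ψ[1,a]Ψ[a,1]e(ν) = e(ν). (2) If |ν_1 − ν_i| ≥ 2 for 2 ≤ i ≤ a+1, then Ψ[a,1]Ψ[1,a]e(ν) = e(ν). (3) If ν_1 = ν_{a+1} and ν_{a+1} ≠ ν_i for 2 ≤ i ≤ a, then x_{a+1}Ψ[1,a]e(ν) = (Ψ[1,a]x_1 + Ψ[1,a−1])e(ν). (4) If ν_1 = ν_{a+1} and ν_{a+1} ≠ ν_i for 2 ≤ i ≤ a, then x_1Ψ[a,1]e(ν) = (Ψ[a,1]x_{a+1} − Ψ_2(1,a−1,1))e(ν). (5) If |ν_i − ν_j| ≥ 2 for all 1 ≤ i ≤ a and a+1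 ≤ j ≤ a+b, then Ψ[b,a]Ψ[a,b]e(ν) = e(ν). -/
namespace QH

/-- Generators of the quiver Hecke algebra of type `C_∞` on `n` strands:
idempotents `e(ν)` for sequences `ν ∈ I^n` (`I = ℤ_{≥0}`), polynomial generators
`x_1, …, x_n` and intertwiners `ψ_1, …, ψ_{n−1}` (1-based; out-of-range generators are
set to `0` by the relations below). -/
inductive Gen (n : ℕ) : Type
  | e : (Fin n → ℕ) → Gen n
  | x : ℕ → Gen n
  | p : ℕ → Gen n

variable (k : Type) [Field k] {n : ℕ}

/-- The free algebra on the generators. -/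
abbrev FA (k : Type) [Field k] (n : ℕ) : Type := FreeAlgebra k (Gen n)

def E (ν : Fin n → ℕ) : FA k n := FreeAlgebra.ι k (Gen.e ν)
def X (r : ℕ) : FA k n := FreeAlgebra.ι k (Gen.x r)
def P (r : ℕ) : FA k n := FreeAlgebra.ι k (Gen.p r)

/-- The entry of `ν` at the 1-based position `p` (junk value `0` out of range). -/
def seqAt (ν : Fin n → ℕ) (p : ℕ) : ℕ :=
  if h : 1 ≤ p ∧ p ≤ n then ν ⟨p - 1, by omega⟩ else 0

/-- `s_r ν`: the sequence `ν` with its entries at the (1-based) positions `r`, `r+1`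
exchanged. -/
def swapAt (ν : Fin n → ℕ) (r : ℕ) : Fin n → ℕ := fun m =>
  if (m : ℕ) + 1 = r then seqAt ν (r + 1)
  else if (m : ℕ) + 1 = r + 1 then seqAt ν r
  else ν m

/-- The finite set `I^β`: all sequences with the same content as `ν₀`. -/
def cls (ν₀ : Fin n → ℕ) : Finset (Fin n → ℕ) :=
  Finset.image (fun σ : Equiv.Perm (Fin n) => ν₀ ∘ σ) Finset.univ

/-- The polynomials `Q_{i,j}(u,v)` of type `C_∞`:
`Q_{0,1}(u,v) = u + v²`, `Q_{i,i+1}(u,v) = u + v` for `i ≠ 0`, `Q_{i,j} = 1` for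
`|i − j| ≥ 2`, `Q_{i,i} = 0`, and `Q_{j,i}(u,v) = Q_{i,j}(v,u)`. -/
def Qpol (i j : ℕ) (u v : FA k n) : FA k n :=
  if i = j then 0
  else if i = 0 ∧ j = 1 then u + v * v
  else if i = 1 ∧ j = 0 then u * u + v
  else if i + 1 = j ∨ j + 1 = i then u + v
  else 1

/-- The divided difference `(Q_{i,j}(u, v) − Q_{i,j}(w, v))/(u − w)` of type `C_∞`
(the `v`-dependence cancels), appearing in the braid relation. -/
def QDD (i j : ℕ) (u w : FA k n) : FA k n :=
  if i = j then 0
  else if i = 1 ∧ j = 0 then u + w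
  else if i = 0 ∧ j = 1 then 1
  else if i + 1 = j ∨ j + 1 = i then 1
  else 0

/-- The defining relations of the quiver Hecke algebra `R(β)` of type `C_∞`, where
`β = α_{ν₀ 1} + … + α_{ν₀ n}`. -/
inductive Rel (ν₀ : Fin n → ℕ) : FA k n → FA k n → Prop
  | idem (ν ν' : Fin n → ℕ) :
      Rel ν₀ (E k ν * E k ν') (if ν = ν' then E k ν else 0)
  | support (ν : Fin n → ℕ) (h : ν ∉ cls ν₀) : Rel ν₀ (E k ν) 0
  | total : Rel ν₀ (∑ ν ∈ cls ν₀, E k ν) 1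
  | xzero (r : ℕ) (h : r = 0 ∨ n < r) : Rel ν₀ (X k r) 0
  | pzero (r : ℕ) (h : r = 0 ∨ n ≤ r) : Rel ν₀ (P k r) 0
  | xe (r : ℕ) (ν : Fin n → ℕ) : Rel ν₀ (X k r * E k ν) (E k ν * X k r)
  | pe (r : ℕ) (h1 : 1 ≤ r) (h2 : r + 1 ≤ n) (ν : Fin n → ℕ) :
      Rel ν₀ (P k r * E k ν) (E k (swapAt ν r) * P k r)
  | xx (r s : ℕ) : Rel ν₀ (X k r * X k s) (X k s * X k r)
  | px (r s : ℕ) (h : s ≠ r) (h' : s ≠ r + 1) :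
      Rel ν₀ (P k r * X k s) (X k s * P k r)
  | pp (r s : ℕ) (h : r + 1 < s) : Rel ν₀ (P k r * P k s) (P k s * P k r)
  | xp (r : ℕ) (h1 : 1 ≤ r) (h2 : r + 1 ≤ n) (ν : Fin n → ℕ) :
      Rel ν₀ (X k r * P k r * E k ν)
        (P k r * X k (r + 1) * E k ν -
          (if seqAt ν r = seqAt ν (r + 1) then E k ν else 0))
  | px' (r : ℕ) (h1 : 1 ≤ r) (h2 : r + 1 ≤ n) (ν : Fin n → ℕ) :
      Rel ν₀ (X k (r + 1) * P k r * E k ν)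
        (P k r * X k r * E k ν +
          (if seqAt ν r = seqAt ν (r + 1) then E k ν else 0))
  | psq (r : ℕ) (h1 : 1 ≤ r) (h2 : r + 1 ≤ n) (ν : Fin n → ℕ) :
      Rel ν₀ (P k r * P k r * E k ν)
        (Qpol k (seqAt ν r) (seqAt ν (r + 1)) (X k r) (X k (r + 1)) * E k ν)
  | braid (r : ℕ) (h1 : 1 ≤ r) (h2 : r + 2 ≤ n) (ν : Fin n → ℕ) :
      Rel ν₀ ((P k (r + 1) * P k r * P k (r + 1) - P k r * P k (r + 1) * P k r) * E k ν)
        (if seqAt ν r = seqAt ν (r + 2)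
         then QDD k (seqAt ν r) (seqAt ν (r + 1)) (X k r) (X k (r + 2)) * E k ν
         else 0)

/-- The quiver Hecke algebra `R(β)` of type `C_∞` over `k`, for
`β = α_{ν₀ 1} + … + α_{ν₀ n}`. -/
abbrev Alg (ν₀ : Fin n → ℕ) : Type := RingQuot (Rel k ν₀)

/-- The quotient map. -/
def mk (ν₀ : Fin n → ℕ) : FA k n →ₐ[k] Alg k ν₀ := RingQuot.mkAlgHom k (Rel k ν₀)

def Ee (ν₀ ν : Fin n → ℕ) : Alg k ν₀ := mk k ν₀ (E k ν)
def Xe (ν₀ : Fin n → ℕ) (r : ℕ) : Alg k ν₀ := mk k ν₀ (X k r)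
def Pe (ν₀ : Fin n → ℕ) (r : ℕ) : Alg k ν₀ := mk k ν₀ (P k r)

/-- `ψ_L` for a word `L` in the simple transpositions (1-based letters). -/
def psiW (ν₀ : Fin n → ℕ) (L : List ℕ) : Alg k ν₀ := (L.map (Pe k ν₀)).prod

/-- The canonical reduced word for the block transposition `w[a,b]`:
`(s_b ⋯ s_{a+b−1})(s_{b−1} ⋯ s_{a+b−2}) ⋯ (s_1 ⋯ s_a)`. -/
def wordW (a b : ℕ) : List ℕ :=
  (List.range b).flatMap (fun m => (List.range a).map (fun i => b - m + i))

/-- `Ψ[a,b] := ψ_{w[a,b]}` (for the canonical reduced word; `w[a,b]` is fully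
commutative, so this is independent of the choice). -/
def PsiBr (ν₀ : Fin n → ℕ) (a b : ℕ) : Alg k ν₀ := psiW k ν₀ (wordW a b)

/-- `Ψ₂(c,a,b)`: the shift of `Ψ[a,b]` by `c`. -/
def PsiSh (ν₀ : Fin n → ℕ) (c a b : ℕ) : Alg k ν₀ :=
  psiW k ν₀ ((wordW a b).map (fun i => i + c))

end QH

open QH

namespace QH

section

variable (k : Type) [Field k] {n : ℕ} (ν₀ : Fin n → ℕ)

lemma mk_eq_of_rel {a b : FA k n} (h : Rel k ν₀ a b) : mk k ν₀ a = mk k ν₀ b :=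
  RingQuot.mkAlgHom_rel k h

lemma Pe_mul_Ee {r : ℕ} (h1 : 1 ≤ r) (h2 : r + 1 ≤ n) (ν : Fin n → ℕ) :
    Pe k ν₀ r * Ee k ν₀ ν = Ee k ν₀ (swapAt ν r) * Pe k ν₀ r := by
  simpa [Pe, Ee] using mk_eq_of_rel k ν₀ (Rel.pe r h1 h2 ν)

lemma Pe_commute {r s : ℕ} (h : r + 1 < s) : Commute (Pe k ν₀ r) (Pe k ν₀ s) := by
  simpa [Pe, Commute, SemiconjBy] using mk_eq_of_rel k ν₀ (Rel.pp r s h)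

lemma Xe_mul_Pe_mul_Ee {r : ℕ} (h1 : 1 ≤ r) (h2 : r + 1 ≤ n) (ν : Fin n → ℕ) :
    Xe k ν₀ r * Pe k ν₀ r * Ee k ν₀ ν = Pe k ν₀ r * Xe k ν₀ (r + 1) * Ee k ν₀ ν -
      if seqAt ν r = seqAt ν (r + 1) then Ee k ν₀ ν else 0 := by
  have h := mk_eq_of_rel k ν₀ (Rel.xp r h1 h2 ν)
  split_ifs at h ⊢ <;> simpa [Xe, Pe, Ee] using h

lemma Xe_succ_mul_Pe_mul_Ee {r : ℕ} (h1 : 1 ≤ r) (h2 : r + 1 ≤ n) (ν : Fin n → ℕ) :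
    Xe k ν₀ (r + 1) * Pe k ν₀ r * Ee k ν₀ ν = Pe k ν₀ r * Xe k ν₀ r * Ee k ν₀ ν +
      if seqAt ν r = seqAt ν (r + 1) then Ee k ν₀ ν else 0 := by
  have h := mk_eq_of_rel k ν₀ (Rel.px' r h1 h2 ν)
  split_ifs at h ⊢ <;> simpa [Xe, Pe, Ee] using h

lemma Pe_mul_Pe_mul_Ee {r : ℕ} (h1 : 1 ≤ r) (h2 : r + 1 ≤ n) {ν : Fin n → ℕ}
    (hν : 2 ≤ ((seqAt ν r : ℤ) - (seqAt ν (r + 1) : ℤ)).natAbs) :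
    Pe k ν₀ r * Pe k ν₀ r * Ee k ν₀ ν = Ee k ν₀ ν := by
  have h := mk_eq_of_rel k ν₀ (Rel.psq r h1 h2 ν)
  have hQ : Qpol k (seqAt ν r) (seqAt ν (r + 1)) (X k r) (X k (r + 1)) = (1 : FA k n) := by
    unfold Qpol
    rw [if_neg (by omega), if_neg (by omega), if_neg (by omega), if_neg (by omega)]
  rw [hQ] at h
  simpa [Pe, Ee] using h

@[simp]
lemma psiW_nil : psiW k ν₀ [] = 1 := by simp [psiW]

@[simp]
lemma psiW_cons (l : ℕ) (L : List ℕ) : psiW k ν₀ (l :: L) = Pe k ν₀ l * psiW k ν₀ L := by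
  simp [psiW]

@[simp]
lemma psiW_append (L M : List ℕ) : psiW k ν₀ (L ++ M) = psiW k ν₀ L * psiW k ν₀ M := by
  simp [psiW]

lemma psiW_flatMap_range (b : ℕ) (f : ℕ → List ℕ) :
    psiW k ν₀ ((List.range b).flatMap f) = ((List.range b).map fun i => psiW k ν₀ (f i)).prod := by
  induction b with
  | zero => simp
  | succ b ih => simp [List.range_succ, ih]

lemma psiW_commute_Pe {L : List ℕ} {s : ℕ} (h : ∀ l ∈ L, l + 1 < s) :
    Commute (psiW k ν₀ L) (Pe k ν₀ s) := by
  induction L with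
  | nil => simp
  | cons l L ih =>
    rw [psiW_cons]
    exact (Pe_commute k ν₀ (h l (by simp))).mul_left (ih fun m hm => h m (by simp [hm]))

end

/-- In a monoid, `∏ fᵢ gᵢ = (∏ fᵢ) (∏ gᵢ)` as soon as each `gᵢ` commutes with all later `fⱼ`. -/
lemma prod_map_range_mul {M : Type*} [Monoid M] (f g : ℕ → M) (b : ℕ)
    (h : ∀ i j, i < j → j < b → Commute (g i) (f j)) :
    ((List.range b).map fun i => f i * g i).prod =
      ((List.range b).map f).prod * ((List.range b).map g).prod := by
  induction b with
  | zero => simp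
  | succ b ih =>
    have hc : Commute ((List.range b).map g).prod (f b) := by
      refine Commute.list_prod_left _ _ fun y hy => ?_
      obtain ⟨i, hi, rfl⟩ := List.mem_map.1 hy
      exact h i b (List.mem_range.1 hi) (by omega)
    simp only [List.range_succ, List.map_append, List.map_cons, List.map_nil, List.prod_append,
      List.prod_cons, List.prod_nil, mul_one]
    rw [ih fun i j hij hj => h i j hij (by omega), mul_assoc, mul_assoc, ← mul_assoc _ (f b),
      hc.eq, mul_assoc]

/-- The word `c, c + 1, …, c + a - 1`. -/
def ascWord (c a : ℕ) : List ℕ := (List.range a).map (c + ·)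

@[simp]
lemma ascWord_zero (c : ℕ) : ascWord c 0 = [] := rfl

lemma ascWord_succ (c a : ℕ) : ascWord c (a + 1) = c :: ascWord (c + 1) a := by
  simp only [ascWord, List.range_succ_eq_map, List.map_cons, List.map_map, add_zero]
  congr 1
  refine List.map_congr_left fun i _ => ?_
  simp only [Function.comp_apply]
  omega

lemma ascWord_succ' (c a : ℕ) : ascWord c (a + 1) = ascWord c a ++ [c + a] := by
  simp [ascWord, List.range_succ]

lemma mem_ascWord {c a l : ℕ} : l ∈ ascWord c a ↔ c ≤ l ∧ l < c + a := by
  simp only [ascWord, List.mem_map, List.mem_range]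
  exact ⟨by rintro ⟨i, hi, rfl⟩; omega, fun h => ⟨l - c, by omega, by omega⟩⟩

@[simp]
lemma wordW_zero (a : ℕ) : wordW a 0 = [] := rfl

lemma wordW_succ (a b : ℕ) : wordW a (b + 1) = ascWord (b + 1) a ++ wordW a b := by
  simp only [wordW, ascWord, List.range_succ_eq_map, List.flatMap_cons, List.flatMap_map]
  simp

lemma wordW_one_right (a : ℕ) : wordW a 1 = ascWord 1 a := by
  simp [wordW_succ]

lemma wordW_one_left_succ (b : ℕ) : wordW 1 (b + 1) = (b + 1) :: wordW 1 b := by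
  simp [wordW_succ, ascWord_succ]

lemma reverse_wordW (a b : ℕ) :
    (wordW a b).reverse = (List.range b).flatMap fun i => (ascWord (i + 1) a).reverse := by
  induction b with
  | zero => simp
  | succ b ih => simp [wordW_succ, List.range_succ, ih]

lemma ascWord_reverse_succ (c a : ℕ) :
    (ascWord c (a + 1)).reverse = (c + a) :: (ascWord c a).reverse := by
  simp [ascWord_succ']

/-- `ψ` of the reversed word of `w[a,b]` is `Ψ[b,a]`. -/
lemma psiW_reverse_wordW (k : Type) [Field k] {n : ℕ} (ν₀ : Fin n → ℕ) (a b : ℕ) :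
    psiW k ν₀ (wordW a b).reverse = PsiBr k ν₀ b a := by
  induction a with
  | zero =>
    rw [reverse_wordW, psiW_flatMap_range]
    simp [PsiBr]
  | succ a ih =>
    have hf : psiW k ν₀ (ascWord (a + 1) b) =
        ((List.range b).map fun i => Pe k ν₀ (i + 1 + a)).prod := by
      simp only [psiW, ascWord, List.map_map]
      refine congrArg List.prod (List.map_congr_left fun i _ => ?_)
      simp only [Function.comp_apply]
      congr 1
      omega
    rw [PsiBr, wordW_succ, psiW_append, hf, ← PsiBr, ← ih, reverse_wordW, reverse_wordW,
      psiW_flatMap_range, psiW_flatMap_range, ← prod_map_range_mul]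
    · simp only [ascWord_reverse_succ, psiW_cons]
    · intro i j hij _
      refine psiW_commute_Pe k ν₀ fun l hl => ?_
      rw [List.mem_reverse, mem_ascWord] at hl
      omega

section

variable {n : ℕ}

lemma seqAt_swapAt {r : ℕ} (h1 : 1 ≤ r) (h2 : r + 1 ≤ n) (ν : Fin n → ℕ) (p : ℕ) :
    seqAt (swapAt ν r) p =
      if p = r then seqAt ν (r + 1) else if p = r + 1 then seqAt ν r else seqAt ν p := by
  by_cases hp : 1 ≤ p ∧ p ≤ n
  · have hp' : p - 1 + 1 = p := by omega
    rw [seqAt, dif_pos hp]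
    simp only [swapAt, hp']
    split_ifs
    · rfl
    · rfl
    · rw [seqAt, dif_pos hp]
  · rw [if_neg (by omega), if_neg (by omega), seqAt, seqAt, dif_neg hp, dif_neg hp]

/-- The action of a word in the simple transpositions on sequences. -/
def act (L : List ℕ) (ν : Fin n → ℕ) : Fin n → ℕ := L.foldr (fun l μ => swapAt μ l) ν

@[simp]
lemma act_nil (ν : Fin n → ℕ) : act [] ν = ν := rfl

@[simp]
lemma act_cons (l : ℕ) (L : List ℕ) (ν : Fin n → ℕ) : act (l :: L) ν = swapAt (act L ν) l := rfl

lemma act_append (L M : List ℕ) (ν : Fin n → ℕ) : act (L ++ M) ν = act L (act M ν) := by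
  simp [act]

lemma seqAt_act_ascWord {c a : ℕ} (hc : 1 ≤ c) (h : c + a ≤ n) (ν : Fin n → ℕ) (p : ℕ) :
    seqAt (act (ascWord c a) ν) p =
      if p = c then seqAt ν (c + a)
      else if c < p ∧ p ≤ c + a then seqAt ν (p - 1) else seqAt ν p := by
  induction a generalizing c p with
  | zero =>
    simp only [ascWord_zero, act_nil, add_zero]
    split_ifs with h1 h2
    · rw [h1]
    · omega
    · rfl
  | succ a ih =>
    rw [ascWord_succ, act_cons, seqAt_swapAt hc (by omega)]
    simp only [ih (c := c + 1) (by omega) (by omega)]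
    split_ifs <;> first | omega | (congr 1; omega)

lemma seqAt_act_wordW {a b : ℕ} (h : a + b ≤ n) (ν : Fin n → ℕ) {p : ℕ} (hp : 1 ≤ p) :
    seqAt (act (wordW a b) ν) p =
      if p ≤ b then seqAt ν (a + p) else if p ≤ a + b then seqAt ν (p - b) else seqAt ν p := by
  induction b generalizing p with
  | zero =>
    simp only [wordW_zero, act_nil]
    split_ifs <;> first | omega | rfl
  | succ b ih =>
    rw [wordW_succ, act_append, seqAt_act_ascWord (by omega) (by omega)]
    split_ifs <;> rw [ih (by omega) (by omega)] <;> split_ifs <;> first | omega | (congr 1; omega)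

/-- Every letter of `L`, read from the right, is in range and exchanges two entries of `ν` that
are at distance at least two. -/
def Separated (ν : Fin n → ℕ) : List ℕ → Prop
  | [] => True
  | l :: L => (1 ≤ l ∧ l + 1 ≤ n ∧
      2 ≤ ((seqAt (act L ν) l : ℤ) - (seqAt (act L ν) (l + 1) : ℤ)).natAbs) ∧ Separated ν L

lemma Separated.append {ν : Fin n → ℕ} {L M : List ℕ} (hL : Separated (act M ν) L)
    (hM : Separated ν M) : Separated ν (L ++ M) := by
  induction L with
  | nil => exact hM
  | cons l L ih =>
    refine ⟨?_, ih hL.2⟩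
    have h := hL.1
    rwa [← act_append] at h

lemma separated_ascWord {c a : ℕ} (hc : 1 ≤ c) (h : c + a ≤ n) {ν : Fin n → ℕ}
    (hν : ∀ i, c ≤ i → i < c + a → 2 ≤ ((seqAt ν i : ℤ) - (seqAt ν (c + a) : ℤ)).natAbs) :
    Separated ν (ascWord c a) := by
  induction a generalizing c with
  | zero => trivial
  | succ a ih =>
    have e : c + 1 + a = c + (a + 1) := by omega
    rw [ascWord_succ]
    refine ⟨⟨hc, by omega, ?_⟩, ih (by omega) (by omega) fun i hi hi' => ?_⟩
    · rw [seqAt_act_ascWord (by omega) (by omega), seqAt_act_ascWord (by omega) (by omega),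
        if_neg (by omega), if_neg (by omega), if_pos rfl, e]
      exact hν c le_rfl (by omega)
    · rw [e]
      exact hν i (by omega) (by omega)

lemma separated_wordW {a b : ℕ} (h : a + b ≤ n) {ν : Fin n → ℕ}
    (hν : ∀ i j, 1 ≤ i → i ≤ a → a + 1 ≤ j → j ≤ a + b →
      2 ≤ ((seqAt ν i : ℤ) - (seqAt ν j : ℤ)).natAbs) :
    Separated ν (wordW a b) := by
  induction b with
  | zero => trivial
  | succ b ih =>
    rw [wordW_succ]
    refine (separated_ascWord (by omega) (by omega) fun i hi hi' => ?_).append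
      (ih (by omega) fun i j hi hi' hj hj' => hν i j hi hi' hj (by omega))
    rw [seqAt_act_wordW (by omega) _ (by omega), seqAt_act_wordW (by omega) _ (by omega),
      if_neg (by omega), if_pos (by omega), if_neg (by omega), if_neg (by omega)]
    exact hν _ _ (by omega) (by omega) (by omega) (by omega)

end

section

variable (k : Type) [Field k] {n : ℕ} (ν₀ : Fin n → ℕ)

lemma psiW_mul_Ee {L : List ℕ} (hL : ∀ l ∈ L, 1 ≤ l ∧ l + 1 ≤ n) (ν : Fin n → ℕ) :
    psiW k ν₀ L * Ee k ν₀ ν = Ee k ν₀ (act L ν) * psiW k ν₀ L := by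
  induction L with
  | nil => simp
  | cons l L ih =>
    have hl := hL l (by simp)
    rw [psiW_cons, mul_assoc, ih fun m hm => hL m (by simp [hm]), ← mul_assoc,
      Pe_mul_Ee k ν₀ hl.1 hl.2, mul_assoc, act_cons]

lemma Separated.mem_range {ν : Fin n → ℕ} {L : List ℕ} (h : Separated ν L) :
    ∀ l ∈ L, 1 ≤ l ∧ l + 1 ≤ n := by
  induction L with
  | nil => simp
  | cons l L ih =>
    intro m hm
    rcases List.mem_cons.1 hm with rfl | hm
    · exact ⟨h.1.1, h.1.2.1⟩
    · exact ih h.2 m hm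

lemma psiW_reverse_mul_psiW_mul_Ee {ν : Fin n → ℕ} {L : List ℕ} (h : Separated ν L) :
    psiW k ν₀ L.reverse * psiW k ν₀ L * Ee k ν₀ ν = Ee k ν₀ ν := by
  induction L with
  | nil => simp
  | cons l L ih =>
    obtain ⟨⟨h1, h2, h3⟩, hL⟩ := h
    calc psiW k ν₀ (l :: L).reverse * psiW k ν₀ (l :: L) * Ee k ν₀ ν
        = psiW k ν₀ L.reverse * (Pe k ν₀ l * Pe k ν₀ l * (psiW k ν₀ L * Ee k ν₀ ν)) := by
          simp [mul_assoc]
      _ = psiW k ν₀ L.reverse *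
            (Pe k ν₀ l * Pe k ν₀ l * Ee k ν₀ (act L ν) * psiW k ν₀ L) := by
          rw [psiW_mul_Ee k ν₀ hL.mem_range, mul_assoc _ (Ee k ν₀ _)]
      _ = psiW k ν₀ L.reverse * psiW k ν₀ L * Ee k ν₀ ν := by
          rw [Pe_mul_Pe_mul_Ee k ν₀ h1 h2 h3, ← psiW_mul_Ee k ν₀ hL.mem_range, mul_assoc]
      _ = Ee k ν₀ ν := ih hL

lemma PsiBr_mul_PsiBr_mul_Ee {a b : ℕ} (h : a + b ≤ n) {ν : Fin n → ℕ}
    (hν : ∀ i j, 1 ≤ i → i ≤ a → a + 1 ≤ j → j ≤ a + b →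
      2 ≤ ((seqAt ν i : ℤ) - (seqAt ν j : ℤ)).natAbs) :
    PsiBr k ν₀ b a * PsiBr k ν₀ a b * Ee k ν₀ ν = Ee k ν₀ ν := by
  rw [← psiW_reverse_wordW k ν₀ a b]
  exact psiW_reverse_mul_psiW_mul_Ee k ν₀ (separated_wordW h hν)

lemma Xe_succ_mul_psiW_cons_mul_Ee {r : ℕ} {L : List ℕ}
    (hL : ∀ l ∈ r :: L, 1 ≤ l ∧ l + 1 ≤ n) (ν : Fin n → ℕ) :
    Xe k ν₀ (r + 1) * psiW k ν₀ (r :: L) * Ee k ν₀ ν =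
      Pe k ν₀ r * (Xe k ν₀ r * psiW k ν₀ L * Ee k ν₀ ν) +
        if seqAt (act L ν) r = seqAt (act L ν) (r + 1) then psiW k ν₀ L * Ee k ν₀ ν else 0 := by
  have hr := hL r (by simp)
  have h := psiW_mul_Ee k ν₀ (fun l hl => hL l (List.mem_cons_of_mem r hl)) ν
  have hx := congrArg (· * psiW k ν₀ L) (Xe_succ_mul_Pe_mul_Ee k ν₀ hr.1 hr.2 (act L ν))
  simp only [add_mul, ite_mul, zero_mul, mul_assoc, ← h] at hx
  simpa only [psiW_cons, mul_assoc] using hx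

lemma Xe_mul_psiW_cons_mul_Ee {r : ℕ} {L : List ℕ}
    (hL : ∀ l ∈ r :: L, 1 ≤ l ∧ l + 1 ≤ n) (ν : Fin n → ℕ) :
    Xe k ν₀ r * psiW k ν₀ (r :: L) * Ee k ν₀ ν =
      Pe k ν₀ r * (Xe k ν₀ (r + 1) * psiW k ν₀ L * Ee k ν₀ ν) -
        if seqAt (act L ν) r = seqAt (act L ν) (r + 1) then psiW k ν₀ L * Ee k ν₀ ν else 0 := by
  have hr := hL r (by simp)
  have h := psiW_mul_Ee k ν₀ (fun l hl => hL l (List.mem_cons_of_mem r hl)) ν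
  have hx := congrArg (· * psiW k ν₀ L) (Xe_mul_Pe_mul_Ee k ν₀ hr.1 hr.2 (act L ν))
  simp only [sub_mul, ite_mul, zero_mul, mul_assoc, ← h] at hx
  simpa only [psiW_cons, mul_assoc] using hx

lemma mem_wordW_one_left {b l : ℕ} : l ∈ wordW 1 b ↔ 1 ≤ l ∧ l ≤ b := by
  induction b with
  | zero => simp; omega
  | succ b ih =>
    rw [wordW_one_left_succ, List.mem_cons, ih]
    omega

lemma Xe_mul_PsiBr_one_left_succ_mul_Ee {c : ℕ} (hc : c + 2 ≤ n) (ν : Fin n → ℕ) :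
    Xe k ν₀ (c + 2) * PsiBr k ν₀ 1 (c + 1) * Ee k ν₀ ν =
      Pe k ν₀ (c + 1) * (Xe k ν₀ (c + 1) * PsiBr k ν₀ 1 c * Ee k ν₀ ν) +
        if seqAt ν 1 = seqAt ν (c + 2) then PsiBr k ν₀ 1 c * Ee k ν₀ ν else 0 := by
  have h := Xe_succ_mul_psiW_cons_mul_Ee k ν₀ (r := c + 1) (L := wordW 1 c) (fun l hl => by
    rw [← wordW_one_left_succ, mem_wordW_one_left] at hl
    omega) ν
  have e₁ : seqAt (act (wordW 1 c) ν) (c + 1) = seqAt ν 1 := by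
    rw [seqAt_act_wordW (by omega) _ (by omega), if_neg (by omega), if_pos (by omega),
      Nat.add_sub_cancel_left]
  have e₂ : seqAt (act (wordW 1 c) ν) (c + 1 + 1) = seqAt ν (c + 2) := by
    rw [seqAt_act_wordW (by omega) _ (by omega), if_neg (by omega), if_neg (by omega)]
  rw [e₁, e₂, ← wordW_one_left_succ] at h
  exact h

lemma Xe_mul_PsiBr_one_left_mul_Ee {c : ℕ} (hc : c + 1 ≤ n) {ν : Fin n → ℕ}
    (hν : ∀ i, 2 ≤ i → i ≤ c + 1 → seqAt ν 1 ≠ seqAt ν i) :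
    Xe k ν₀ (c + 1) * PsiBr k ν₀ 1 c * Ee k ν₀ ν = PsiBr k ν₀ 1 c * Xe k ν₀ 1 * Ee k ν₀ ν := by
  induction c with
  | zero => simp [PsiBr]
  | succ c ih =>
    rw [Xe_mul_PsiBr_one_left_succ_mul_Ee k ν₀ hc, ih (by omega) fun i hi hi' =>
      hν i hi (by omega), if_neg (hν (c + 2) (by omega) (by omega)), add_zero]
    simp [PsiBr, wordW_one_left_succ, mul_assoc]

lemma Xe_mul_psiW_ascWord_succ_mul_Ee {c a : ℕ} (hc : 1 ≤ c) (h : c + (a + 1) ≤ n)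
    (ν : Fin n → ℕ) :
    Xe k ν₀ c * psiW k ν₀ (ascWord c (a + 1)) * Ee k ν₀ ν =
      Pe k ν₀ c * (Xe k ν₀ (c + 1) * psiW k ν₀ (ascWord (c + 1) a) * Ee k ν₀ ν) -
        if seqAt ν c = seqAt ν (c + (a + 1)) then psiW k ν₀ (ascWord (c + 1) a) * Ee k ν₀ ν
        else 0 := by
  have hx := Xe_mul_psiW_cons_mul_Ee k ν₀ (r := c) (L := ascWord (c + 1) a) (fun l hl => by
    rw [← ascWord_succ, mem_ascWord] at hl
    omega) ν
  have e₁ : seqAt (act (ascWord (c + 1) a) ν) c = seqAt ν c := by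
    rw [seqAt_act_ascWord (by omega) (by omega), if_neg (by omega), if_neg (by omega)]
  have e₂ : seqAt (act (ascWord (c + 1) a) ν) (c + 1) = seqAt ν (c + (a + 1)) := by
    rw [seqAt_act_ascWord (by omega) (by omega), if_pos rfl, add_assoc, add_comm 1 a]
  rw [e₁, e₂, ← ascWord_succ] at hx
  exact hx

lemma Xe_mul_psiW_ascWord_mul_Ee {c a : ℕ} (hc : 1 ≤ c) (h : c + a ≤ n) {ν : Fin n → ℕ}
    (hν : ∀ i, c ≤ i → i < c + a → seqAt ν i ≠ seqAt ν (c + a)) :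
    Xe k ν₀ c * psiW k ν₀ (ascWord c a) * Ee k ν₀ ν =
      psiW k ν₀ (ascWord c a) * Xe k ν₀ (c + a) * Ee k ν₀ ν := by
  induction a generalizing c with
  | zero => simp
  | succ a ih =>
    have e : c + 1 + a = c + (a + 1) := by omega
    rw [Xe_mul_psiW_ascWord_succ_mul_Ee k ν₀ hc h, ih (by omega) (by omega) fun i hi hi' => by
      rw [e]; exact hν i (by omega) (by omega), if_neg (hν c le_rfl (by omega)), sub_zero, e,
      ascWord_succ]
    simp [mul_assoc]

end

end QH

/-- (Lemma on block transpositions in the type-`C_∞` quiver Hecke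
algebra.)  Let `ν ∈ I^n`, `a, b > 0`, `a < n`, `a + b ≤ n`.  Then:
(1) if `|ν_i − ν_{a+1}| ≥ 2` for `1 ≤ i ≤ a`, then `Ψ[1,a]Ψ[a,1]e(ν) = e(ν)`;
(2) if `|ν_1 − ν_i| ≥ 2` for `2 ≤ i ≤ a+1`, then `Ψ[a,1]Ψ[1,a]e(ν) = e(ν)`;
(3) if `ν_1 = ν_{a+1} ≠ ν_2, …, ν_a`, then
`x_{a+1}Ψ[1,a]e(ν) = (Ψ[1,a]x_1 + Ψ[1,a−1])e(ν)`;
(4) under the same assumption,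
`x_1Ψ[a,1]e(ν) = (Ψ[a,1]x_{a+1} − Ψ₂(1,a−1,1))e(ν)`;
(5) if `|ν_i − ν_j| ≥ 2` for `1 ≤ i ≤ a < j ≤ a+b`, then `Ψ[b,a]Ψ[a,b]e(ν) = e(ν)`. -/
theorem stmt16 (k : Type) [Field k] (n a b : ℕ)
    (ha : 0 < a) (hb : 0 < b) (han : a < n) (habn : a + b ≤ n)
    (ν : Fin n → ℕ) :
    ((∀ i, 1 ≤ i → i ≤ a → 2 ≤ ((seqAt ν i : ℤ) - (seqAt ν (a + 1) : ℤ)).natAbs) →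
      PsiBr k ν 1 a * PsiBr k ν a 1 * Ee k ν ν = Ee k ν ν) ∧
    ((∀ i, 2 ≤ i → i ≤ a + 1 → 2 ≤ ((seqAt ν 1 : ℤ) - (seqAt ν i : ℤ)).natAbs) →
      PsiBr k ν a 1 * PsiBr k ν 1 a * Ee k ν ν = Ee k ν ν) ∧
    ((seqAt ν 1 = seqAt ν (a + 1) ∧
        ∀ i, 2 ≤ i → i ≤ a → seqAt ν i ≠ seqAt ν (a + 1)) →
      Xe k ν (a + 1) * PsiBr k ν 1 a * Ee k ν ν =
        PsiBr k ν 1 a * Xe k ν 1 * Ee k ν ν + PsiBr k ν 1 (a - 1) * Ee k ν ν) ∧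
    ((seqAt ν 1 = seqAt ν (a + 1) ∧
        ∀ i, 2 ≤ i → i ≤ a → seqAt ν i ≠ seqAt ν (a + 1)) →
      Xe k ν 1 * PsiBr k ν a 1 * Ee k ν ν =
        PsiBr k ν a 1 * Xe k ν (a + 1) * Ee k ν ν - PsiSh k ν 1 (a - 1) 1 * Ee k ν ν) ∧
    ((∀ i j, 1 ≤ i → i ≤ a → a + 1 ≤ j → j ≤ a + b →
        2 ≤ ((seqAt ν i : ℤ) - (seqAt ν j : ℤ)).natAbs) →
      PsiBr k ν b a * PsiBr k ν a b * Ee k ν ν = Ee k ν ν) := by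
  refine ⟨fun h => ?_, fun h => ?_, fun h => ?_, fun h => ?_, PsiBr_mul_PsiBr_mul_Ee k ν habn⟩
  · refine PsiBr_mul_PsiBr_mul_Ee k ν (by omega) fun i j hi hi' hj hj' => ?_
    obtain rfl : j = a + 1 := by omega
    exact h i hi hi'
  · refine PsiBr_mul_PsiBr_mul_Ee k ν (by omega) fun i j hi hi' hj hj' => ?_
    obtain rfl : i = 1 := by omega
    exact h j (by omega) (by omega)
  · obtain ⟨c, rfl⟩ : ∃ c, a = c + 1 := ⟨a - 1, by omega⟩
    obtain ⟨h1, h2⟩ := h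
    rw [Xe_mul_PsiBr_one_left_succ_mul_Ee k ν (by omega), if_pos h1,
      Xe_mul_PsiBr_one_left_mul_Ee k ν (by omega) fun i hi hi' => h1 ▸ (h2 i hi hi').symm]
    simp [PsiBr, wordW_one_left_succ, mul_assoc]
  · obtain ⟨c, rfl⟩ : ∃ c, a = c + 1 := ⟨a - 1, by omega⟩
    obtain ⟨h1, h2⟩ := h
    have e : 1 + 1 + c = c + 1 + 1 := by omega
    have hs : (wordW c 1).map (fun i => i + 1) = ascWord (1 + 1) c := by
      rw [wordW_one_right, ascWord, ascWord, List.map_map]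
      refine List.map_congr_left fun i _ => ?_
      simp only [Function.comp_apply]
      omega
    rw [PsiBr, PsiSh, Nat.add_sub_cancel, hs, wordW_one_right,
      Xe_mul_psiW_ascWord_succ_mul_Ee k ν le_rfl (by omega), add_comm 1 (c + 1), if_pos h1,
      Xe_mul_psiW_ascWord_mul_Ee k ν (by omega) (by omega) fun i hi hi' => by
        rw [e]; exact h2 i hi (by omega), e, ascWord_succ]
    simp [mul_assoc]
end
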